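/- arXiv:2309.11185 — 5 statements merged into one kernel-verified Lean document; each statement's English description precedes it below -/
import Mathlib

section
/- (Differential equation for the GinOE moment generating function, τ = 0.) For every even integer N ≥ 2, the function M_0(t) satisfies Σ_{k=1}^{7} C_k(t)·M_0^{(k)}(t) = 0 for all t ∈ ℝ, where C_7(t) = 2t⁴, C_6(t) = −3t⁵+2t³, C_5(t) = t⁶−(4N+13)t⁴−42t², C_4(t) = (3N+5)t⁵+4(N+10)t³+120t, C_3(t) = (N−1)(2N+3)t⁴+36N t²−120, C_2(t) = −6(N+1)²t³−120(N+1)t, C_1(t) = 6(N+1)²t²+120(N+1). -/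
open Real MeasureTheory Finset

/-- The rescaled (monic-type) Hermite polynomials `C_k` with parameter `τ`:
`C_0(x) = 1`, `C_1(x) = x`, `C_{k+1}(x) = x·C_k(x) − k·τ·C_{k−1}(x)`. -/
noncomputable def CH (τ : ℝ) : ℕ → ℝ → ℝ
  | 0 => fun _ => 1
  | 1 => fun x => x
  | (k+2) => fun x => x * CH τ (k+1) x - ((k : ℝ) + 1) * τ * CH τ k x

/-- The elliptic GinUE part `R_N^{(1)}` of the real-eigenvalue density. -/
noncomputable def R1 (τ : ℝ) (N : ℕ) (x : ℝ) : ℝ :=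
  (Real.exp (-x^2/(1+τ)) / Real.sqrt (2*Real.pi)) *
    ∑ k ∈ Finset.range (N-1), (CH τ k x)^2 / (Nat.factorial k : ℝ)

/-- The correction part `R_N^{(2)}` of the real-eigenvalue density. -/
noncomputable def R2 (τ : ℝ) (N : ℕ) (x : ℝ) : ℝ :=
  (1/((1+τ) * (Nat.factorial (N-2) : ℝ))) * (Real.exp (-x^2/(2*(1+τ))) / Real.sqrt (2*Real.pi)) *
    CH τ (N-1) x * (∫ u in (0:ℝ)..x, Real.exp (-u^2/(2*(1+τ))) * CH τ (N-2) u)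

/-- The density `R_N` of real eigenvalues of the elliptic GinOE. -/
noncomputable def Rd (τ : ℝ) (N : ℕ) (x : ℝ) : ℝ := R1 τ N x + R2 τ N x

/-- The moment generating function of real eigenvalues of the elliptic GinOE. -/
noncomputable def MGF (τ : ℝ) (N : ℕ) (t : ℝ) : ℝ := ∫ x : ℝ, Real.exp (t*x) * Rd τ N x

/-- The `p`-th spectral moment of real eigenvalues of the elliptic GinOE. -/
noncomputable def Mom (τ : ℝ) (N : ℕ) (p : ℕ) : ℝ := ∫ x : ℝ, x^p * Rd τ N x

/-- The elliptic GinUE part `u` of the moment generating function. -/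
noncomputable def uF (τ : ℝ) (N : ℕ) (t : ℝ) : ℝ := ∫ x : ℝ, Real.exp (t*x) * R1 τ N x

/-- The part `v` of the moment generating function coming from `R_N^{(2)}`. -/
noncomputable def vF (τ : ℝ) (N : ℕ) (t : ℝ) : ℝ := ∫ x : ℝ, Real.exp (t*x) * R2 τ N x

/-- A continuous function all of whose two-sided exponential weights are integrable. -/
structure ExpIntegrable (f : ℝ → ℝ) : Prop where
  continuous : Continuous f
  integrable : ∀ a : ℝ, Integrable fun x => Real.exp (a * |x|) * f x

/-- The `k`-th derivative of the two-sided Laplace transform of `f`, as a weighted moment. -/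
noncomputable def expMoment (f : ℝ → ℝ) (k : ℕ) (t : ℝ) : ℝ :=
  ∫ x : ℝ, Real.exp (t * x) * (x ^ k * f x)

namespace ExpIntegrable

variable {f g : ℝ → ℝ}

theorem mono (hg : ExpIntegrable g) (hf : Continuous f) (h : ∀ x, |f x| ≤ |g x|) :
    ExpIntegrable f where
  continuous := hf
  integrable a := by
    refine (hg.integrable a).mono (by fun_prop) (Filter.Eventually.of_forall fun x => ?_)
    simp only [norm_mul, Real.norm_eq_abs]
    exact mul_le_mul_of_nonneg_left (h x) (abs_nonneg _)

theorem add (hf : ExpIntegrable f) (hg : ExpIntegrable g) :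
    ExpIntegrable fun x => f x + g x where
  continuous := hf.continuous.add hg.continuous
  integrable a := by
    simp only [mul_add]
    exact (hf.integrable a).add (hg.integrable a)

theorem const_mul (hf : ExpIntegrable f) (c : ℝ) : ExpIntegrable fun x => c * f x where
  continuous := hf.continuous.const_mul c
  integrable a := by
    simpa only [mul_left_comm] using (hf.integrable a).const_mul c

theorem sum {ι : Type*} {s : Finset ι} {F : ι → ℝ → ℝ} (h : ∀ i ∈ s, ExpIntegrable (F i)) :
    ExpIntegrable fun x => ∑ i ∈ s, F i x where
  continuous := continuous_finsetSum _ fun i hi => (h i hi).continuous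
  integrable a := by
    simpa only [Finset.mul_sum] using integrable_finsetSum _ fun i hi => (h i hi).integrable a

theorem id_mul (hf : ExpIntegrable f) : ExpIntegrable fun x => x * f x where
  continuous := continuous_id.mul hf.continuous
  integrable a := by
    have hc := hf.continuous
    refine (hf.integrable (a + 1)).mono (by fun_prop) (Filter.Eventually.of_forall fun x => ?_)
    simp only [norm_mul, Real.norm_eq_abs, Real.abs_exp]
    rw [add_mul, one_mul, Real.exp_add, mul_assoc]
    have : |x| ≤ Real.exp |x| := by linarith [Real.add_one_le_exp |x|]
    gcongr

theorem pow_mul (hf : ExpIntegrable f) (k : ℕ) : ExpIntegrable fun x => x ^ k * f x := by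
  induction k with
  | zero => simpa using hf
  | succ k ih => simpa only [pow_succ', mul_assoc] using ih.id_mul

theorem integrable_exp_mul (hf : ExpIntegrable f) (t : ℝ) :
    Integrable fun x => Real.exp (t * x) * f x := by
  have hc := hf.continuous
  refine (hf.integrable |t|).mono (by fun_prop) (Filter.Eventually.of_forall fun x => ?_)
  simp only [norm_mul, Real.norm_eq_abs, Real.abs_exp]
  have : t * x ≤ |t| * |x| := (le_abs_self _).trans (abs_mul t x).le
  gcongr

theorem gaussian {b : ℝ} (hb : 0 < b) : ExpIntegrable fun x => Real.exp (-b * x ^ 2) where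
  continuous := by fun_prop
  integrable a := by
    refine ((integrable_exp_neg_mul_sq (half_pos hb)).const_mul
      (Real.exp (a ^ 2 / (2 * b)))).mono (by fun_prop) (Filter.Eventually.of_forall fun x => ?_)
    simp only [Real.norm_eq_abs, Real.abs_exp, ← Real.exp_add]
    refine Real.exp_le_exp.2 ?_
    have h : a ^ 2 / (2 * b) + -(b / 2) * x ^ 2 - (a * |x| + -b * x ^ 2)
        = (a - b * |x|) ^ 2 / (2 * b) := by
      field_simp
      rw [sub_sq, mul_pow, sq_abs]
      ring
    have : 0 ≤ (a - b * |x|) ^ 2 / (2 * b) := by positivity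
    linarith

theorem expMoment_add (hf : ExpIntegrable f) (hg : ExpIntegrable g) (k : ℕ) (t : ℝ) :
    expMoment (fun x => f x + g x) k t = expMoment f k t + expMoment g k t := by
  simp only [expMoment, mul_add]
  exact integral_add ((hf.pow_mul k).integrable_exp_mul t) ((hg.pow_mul k).integrable_exp_mul t)

theorem hasDerivAt_expMoment (hf : ExpIntegrable f) (k : ℕ) (t : ℝ) :
    HasDerivAt (expMoment f k) (expMoment f (k + 1) t) t := by
  have hk := hf.pow_mul k
  have hk' := hf.pow_mul (k + 1)
  have hc := hf.continuous
  refine (hasDerivAt_integral_of_dominated_loc_of_deriv_le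
    (F := fun t x => Real.exp (t * x) * (x ^ k * f x))
    (F' := fun t x => Real.exp (t * x) * (x ^ (k + 1) * f x))
    (bound := fun x => ‖Real.exp ((|t| + 1) * |x|) * (x ^ (k + 1) * f x)‖)
    (Metric.ball_mem_nhds t one_pos)
    (Filter.Eventually.of_forall fun s => (hk.integrable_exp_mul s).aestronglyMeasurable)
    (hk.integrable_exp_mul t) (hk'.integrable_exp_mul t).aestronglyMeasurable
    (Filter.Eventually.of_forall fun x s hs => ?_) (hk'.integrable _).norm
    (Filter.Eventually.of_forall fun x s _ => ?_)).2
  · simp only [norm_mul, Real.norm_eq_abs, Real.abs_exp]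
    rw [Metric.mem_ball, Real.dist_eq] at hs
    have hs' : |s| ≤ |t| + 1 := by linarith [abs_sub_abs_le_abs_sub s t]
    have : s * x ≤ (|t| + 1) * |x| :=
      ((le_abs_self _).trans (abs_mul s x).le).trans
        (mul_le_mul_of_nonneg_right hs' (abs_nonneg x))
    gcongr
  · refine ((hasDerivAt_mul_const x).exp.mul_const (x ^ k * f x)).congr_deriv ?_
    ring

theorem iteratedDeriv_expMoment (hf : ExpIntegrable f) (k : ℕ) :
    iteratedDeriv k (expMoment f 0) = expMoment f k := by
  induction k with
  | zero => exact iteratedDeriv_zero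
  | succ k ih =>
    rw [iteratedDeriv_succ, ih]
    exact funext fun t => (hf.hasDerivAt_expMoment k t).deriv

/-- Integration by parts for weighted moments. -/
theorem expMoment_deriv (hf : ExpIntegrable f) (hg : ExpIntegrable g)
    (h : ∀ x, HasDerivAt f (g x) x) (k : ℕ) (t : ℝ) :
    expMoment g k t = -t * expMoment f k t - k * expMoment f (k - 1) t := by
  have hk := (hf.pow_mul k).integrable_exp_mul t
  have hk₁ := (hf.pow_mul (k - 1)).integrable_exp_mul t
  have hgk := (hg.pow_mul k).integrable_exp_mul t
  have h0 := integral_eq_zero_of_hasDerivAt_of_integrable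
    (f := fun x => Real.exp (t * x) * (x ^ k * f x))
    (f' := fun x => t * (Real.exp (t * x) * (x ^ k * f x))
      + k * (Real.exp (t * x) * (x ^ (k - 1) * f x)) + Real.exp (t * x) * (x ^ k * g x))
    (fun x => by
      refine ((hasDerivAt_const_mul t).exp.mul ((hasDerivAt_pow k x).mul (h x))).congr_deriv ?_
      simp only [Pi.mul_apply]
      ring)
    (((hk.const_mul t).add (hk₁.const_mul k)).add hgk) hk
  rw [integral_add (f := fun x => t * (Real.exp (t * x) * (x ^ k * f x))
      + k * (Real.exp (t * x) * (x ^ (k - 1) * f x)))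
      ((hk.const_mul t).add (hk₁.const_mul k)) hgk,
    integral_add (hk.const_mul t) (hk₁.const_mul k), integral_const_mul, integral_const_mul] at h0
  simp only [expMoment]
  linarith

end ExpIntegrable

theorem expMoment_const_mul (f : ℝ → ℝ) (c : ℝ) (k : ℕ) (t : ℝ) :
    expMoment (fun x => c * f x) k t = c * expMoment f k t := by
  simp only [expMoment, mul_left_comm _ c]
  exact integral_const_mul _ _

theorem expMoment_pow_mul (f : ℝ → ℝ) (j k : ℕ) (t : ℝ) :
    expMoment (fun x => x ^ j * f x) k t = expMoment f (k + j) t := by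
  simp only [expMoment, pow_add, mul_assoc]

theorem ExpIntegrable.expMoment_deriv_id_mul {f g : ℝ → ℝ} (hf : ExpIntegrable f)
    (hg : ExpIntegrable g) (h : ∀ x, HasDerivAt (fun x => x * f x) (g x) x) (k : ℕ) (t : ℝ) :
    expMoment g k t = -t * expMoment f (k + 1) t - k * expMoment f k t := by
  rw [hf.id_mul.expMoment_deriv hg h]
  have hm (j : ℕ) : expMoment (fun x => x * f x) j t = expMoment f (j + 1) t := by
    simpa only [pow_one] using expMoment_pow_mul f 1 j t
  rw [hm, hm]
  cases k <;> simp

theorem CH_zero (k : ℕ) (x : ℝ) : CH 0 k x = x ^ k := by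
  induction k using Nat.twoStepInduction with
  | zero => simp [CH]
  | one => simp [CH]
  | more k _ ih => simp only [CH, ih]; ring

/-- The normalised weight `x ^ (2N - 3) exp (-x²)`, with `N = n + 2`, which governs the
differential equations satisfied by both parts of the density at `τ = 0`. -/
noncomputable def ginWeight (n : ℕ) (x : ℝ) : ℝ :=
  1 / ((n.factorial : ℝ) * Real.sqrt (2 * Real.pi)) * (x ^ (2 * n + 1) * Real.exp (-1 * x ^ 2))

theorem R1_zero (n : ℕ) (x : ℝ) :
    R1 0 (n + 2) x = 1 / Real.sqrt (2 * Real.pi) *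
      ∑ k ∈ Finset.range (n + 1), 1 / (k.factorial : ℝ) * (x ^ (2 * k) * Real.exp (-1 * x ^ 2)) := by
  simp only [R1, CH_zero, show n + 2 - 1 = n + 1 by omega, Finset.mul_sum]
  refine Finset.sum_congr rfl fun k _ => ?_
  rw [add_zero, div_one, neg_one_mul, pow_mul']
  ring

theorem R2_zero (n : ℕ) (x : ℝ) :
    R2 0 (n + 2) x = 1 / ((n.factorial : ℝ) * Real.sqrt (2 * Real.pi)) *
      (x ^ (n + 1) * (Real.exp (-(1 / 2) * x ^ 2) *
        ∫ u in (0:ℝ)..x, Real.exp (-(1 / 2) * u ^ 2) * u ^ n)) := by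
  have h (u : ℝ) : -u ^ 2 / (2 * (1 + 0)) = -(1 / 2) * u ^ 2 := by ring
  simp only [R2, CH_zero, Nat.add_sub_cancel, show n + 2 - 1 = n + 1 by omega, h]
  ring

theorem expIntegrable_ginWeight (n : ℕ) : ExpIntegrable (ginWeight n) :=
  ((ExpIntegrable.gaussian one_pos).pow_mul _).const_mul _

theorem expIntegrable_R1 (n : ℕ) : ExpIntegrable (R1 0 (n + 2)) := by
  rw [funext (R1_zero n)]
  exact (ExpIntegrable.sum fun k _ =>
    ((ExpIntegrable.gaussian one_pos).pow_mul _).const_mul _).const_mul _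

theorem hasDerivAt_integral_gaussian_mul_pow (n : ℕ) (x : ℝ) :
    HasDerivAt (fun x => ∫ u in (0:ℝ)..x, Real.exp (-(1 / 2) * u ^ 2) * u ^ n)
      (Real.exp (-(1 / 2) * x ^ 2) * x ^ n) x := by
  have hc : Continuous fun u : ℝ => Real.exp (-(1 / 2) * u ^ 2) * u ^ n := by fun_prop
  exact hc.integral_hasStrictDerivAt 0 x |>.hasDerivAt

theorem abs_integral_gaussian_mul_pow_le (n : ℕ) (x : ℝ) :
    |∫ u in (0:ℝ)..x, Real.exp (-(1 / 2) * u ^ 2) * u ^ n| ≤ |x| ^ (n + 1) := by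
  have h := intervalIntegral.norm_integral_le_of_norm_le_const (a := 0) (b := x) (C := |x| ^ n)
    (f := fun u => Real.exp (-(1 / 2) * u ^ 2) * u ^ n) fun u hu => ?_
  · simpa [pow_succ] using h
  · have hux : |u| ≤ |x| := by
      simpa using Set.abs_sub_left_of_mem_uIcc (Set.uIoc_subset_uIcc hu)
    rw [norm_mul, norm_pow, Real.norm_eq_abs, Real.norm_eq_abs, Real.abs_exp]
    have : Real.exp (-(1 / 2) * u ^ 2) ≤ 1 := Real.exp_le_one_iff.2 (by nlinarith [sq_nonneg u])
    calc _ ≤ 1 * |x| ^ n := by gcongr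
      _ = _ := one_mul _

theorem expIntegrable_R2 (n : ℕ) : ExpIntegrable (R2 0 (n + 2)) := by
  rw [funext (R2_zero n)]
  refine (ExpIntegrable.pow_mul ?_ _).const_mul _
  refine ((ExpIntegrable.gaussian (b := 1 / 2) (by norm_num)).pow_mul (n + 1)).mono ?_ fun x => ?_
  · have : Continuous fun x => ∫ u in (0:ℝ)..x, Real.exp (-(1 / 2) * u ^ 2) * u ^ n :=
      continuous_iff_continuousAt.2 fun x =>
        (hasDerivAt_integral_gaussian_mul_pow n x).continuousAt
    fun_prop
  · rw [abs_mul, abs_mul, mul_comm, abs_pow]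
    exact mul_le_mul_of_nonneg_right (abs_integral_gaussian_mul_pow_le n x) (abs_nonneg _)

theorem hasDerivAt_gaussian (b x : ℝ) :
    HasDerivAt (fun x => Real.exp (b * x ^ 2)) (2 * b * x * Real.exp (b * x ^ 2)) x := by
  refine ((hasDerivAt_pow 2 x).const_mul b).exp.congr_deriv ?_
  push_cast
  ring

theorem hasDerivAt_R1 (n : ℕ) (x : ℝ) :
    HasDerivAt (R1 0 (n + 2)) (-2 * ginWeight n x) x := by
  rw [funext (R1_zero n)]
  have key : HasDerivAt (fun x : ℝ => ∑ k ∈ Finset.range (n + 1),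
      1 / (k.factorial : ℝ) * (x ^ (2 * k) * Real.exp (-1 * x ^ 2)))
      (-2 * (1 / (n.factorial : ℝ)) * (x ^ (2 * n + 1) * Real.exp (-1 * x ^ 2))) x := by
    induction n with
    | zero =>
      simp only [zero_add, Finset.sum_range_one, mul_zero, pow_zero, one_mul]
      refine ((hasDerivAt_gaussian (-1) x).const_mul (1 / (Nat.factorial 0 : ℝ))).congr_deriv ?_
      ring
    | succ n ih =>
      simp only [Finset.sum_range_succ _ (n + 1)]
      refine (ih.add (((hasDerivAt_pow (2 * (n + 1)) x).mul
        (hasDerivAt_gaussian (-1) x)).const_mul (1 / ((n + 1).factorial : ℝ)))).congr_deriv ?_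
      rw [Nat.factorial_succ, show 2 * (n + 1) - 1 = 2 * n + 1 by omega]
      have : (n.factorial : ℝ) ≠ 0 := by positivity
      have : (n : ℝ) + 1 ≠ 0 := by positivity
      push_cast
      field_simp
      ring
  refine (key.const_mul (1 / Real.sqrt (2 * Real.pi))).congr_deriv ?_
  rw [ginWeight]
  field_simp

theorem hasDerivAt_id_mul_ginWeight (n : ℕ) (x : ℝ) :
    HasDerivAt (fun x => x * ginWeight n x)
      ((2 * n + 2) * ginWeight n x + -2 * (x ^ 2 * ginWeight n x)) x := by
  simp only [ginWeight]
  refine ((hasDerivAt_id x).mul (((hasDerivAt_pow (2 * n + 1) x).mul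
    (hasDerivAt_gaussian (-1) x)).const_mul
    (1 / ((n.factorial : ℝ) * Real.sqrt (2 * Real.pi))))).congr_deriv ?_
  simp only [id_eq, Nat.add_sub_cancel, Pi.mul_apply]
  push_cast
  ring

theorem hasDerivAt_id_mul_R2 (n : ℕ) (x : ℝ) :
    HasDerivAt (fun x => x * R2 0 (n + 2) x)
      ((n + 2) * R2 0 (n + 2) x + (-1 * (x ^ 2 * R2 0 (n + 2) x) + x ^ 1 * ginWeight n x)) x := by
  simp only [R2_zero, ginWeight]
  refine ((hasDerivAt_id x).mul (((hasDerivAt_pow (n + 1) x).mul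
    ((hasDerivAt_gaussian (-(1 / 2)) x).mul
      (hasDerivAt_integral_gaussian_mul_pow n x))).const_mul
    (1 / ((n.factorial : ℝ) * Real.sqrt (2 * Real.pi))))).congr_deriv ?_
  have hexp : Real.exp (-1 * x ^ 2) =
      Real.exp (-(1 / 2) * x ^ 2) * Real.exp (-(1 / 2) * x ^ 2) := by
    rw [← Real.exp_add]
    ring_nf
  rw [hexp]
  simp only [id_eq, Nat.add_sub_cancel, Pi.mul_apply]
  push_cast
  ring

theorem expMoment_R1_rec (n k : ℕ) (t : ℝ) :
    t * expMoment (R1 0 (n + 2)) k t + k * expMoment (R1 0 (n + 2)) (k - 1) t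
      - 2 * expMoment (ginWeight n) k t = 0 := by
  have h := (expIntegrable_R1 n).expMoment_deriv
    ((expIntegrable_ginWeight n).const_mul (-2)) (hasDerivAt_R1 n) k t
  rw [expMoment_const_mul] at h
  linarith

theorem expMoment_ginWeight_rec (n k : ℕ) (t : ℝ) :
    2 * expMoment (ginWeight n) (k + 2) t - t * expMoment (ginWeight n) (k + 1) t
      - (2 * n + 2 + k) * expMoment (ginWeight n) k t = 0 := by
  have hw := expIntegrable_ginWeight n
  have h₁ := hw.const_mul (2 * n + 2)
  have h₂ := (hw.pow_mul 2).const_mul (-2)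
  have h := hw.expMoment_deriv_id_mul (h₁.add h₂) (hasDerivAt_id_mul_ginWeight n) k t
  rw [h₁.expMoment_add h₂, expMoment_const_mul, expMoment_const_mul, expMoment_pow_mul] at h
  linarith

theorem expMoment_R2_rec (n k : ℕ) (t : ℝ) :
    expMoment (R2 0 (n + 2)) (k + 2) t - t * expMoment (R2 0 (n + 2)) (k + 1) t
      - (n + 2 + k) * expMoment (R2 0 (n + 2)) k t - expMoment (ginWeight n) (k + 1) t = 0 := by
  have hv := expIntegrable_R2 n
  have h₁ := hv.const_mul (n + 2)
  have h₂ := (hv.pow_mul 2).const_mul (-1)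
  have h₃ := (expIntegrable_ginWeight n).pow_mul 1
  have h := hv.expMoment_deriv_id_mul (h₁.add (h₂.add h₃)) (hasDerivAt_id_mul_R2 n) k t
  rw [h₁.expMoment_add (h₂.add h₃), h₂.expMoment_add h₃, expMoment_const_mul,
    expMoment_const_mul, expMoment_pow_mul, expMoment_pow_mul] at h
  linarith

theorem iteratedDeriv_MGF_zero (n k : ℕ) (t : ℝ) :
    iteratedDeriv k (MGF 0 (n + 2)) t =
      expMoment (R1 0 (n + 2)) k t + expMoment (R2 0 (n + 2)) k t := by
  have h₁ := expIntegrable_R1 n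
  have h₂ := expIntegrable_R2 n
  have hM : MGF 0 (n + 2) = expMoment (fun x => R1 0 (n + 2) x + R2 0 (n + 2) x) 0 := by
    funext t
    simp [MGF, expMoment, Rd]
  rw [hM, (h₁.add h₂).iteratedDeriv_expMoment, h₁.expMoment_add h₂]

/-- **Theorem (Differential equation for the MGF of the GinOE, `τ = 0`).**
For every even integer `N ≥ 2`, `Σ_{k=1}^{7} C_k(t)·M_0^{(k)}(t) = 0` for all `t ∈ ℝ`. -/
theorem GinOE_MGF_ODE (N : ℕ) (hNeven : Even N) (hN2 : 2 ≤ N) (t : ℝ) :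
    (2*t^4) * iteratedDeriv 7 (MGF 0 N) t
    + (-3*t^5 + 2*t^3) * iteratedDeriv 6 (MGF 0 N) t
    + (t^6 - (4*(N:ℝ)+13)*t^4 - 42*t^2) * iteratedDeriv 5 (MGF 0 N) t
    + ((3*(N:ℝ)+5)*t^5 + 4*((N:ℝ)+10)*t^3 + 120*t) * iteratedDeriv 4 (MGF 0 N) t
    + (((N:ℝ)-1)*(2*(N:ℝ)+3)*t^4 + 36*(N:ℝ)*t^2 - 120) * iteratedDeriv 3 (MGF 0 N) t
    + (-6*((N:ℝ)+1)^2*t^3 - 120*((N:ℝ)+1)*t) * iteratedDeriv 2 (MGF 0 N) t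
    + (6*((N:ℝ)+1)^2*t^2 + 120*((N:ℝ)+1)) * deriv (MGF 0 N) t = 0 := by
  obtain ⟨n, rfl⟩ := Nat.exists_eq_add_of_le' hN2
  rw [← iteratedDeriv_one]
  simp only [iteratedDeriv_MGF_zero]
  have hu := fun k => expMoment_R1_rec n k t
  have hv := fun k => expMoment_R2_rec n k t
  have hw := fun k => expMoment_ginWeight_rec n k t
  push_cast
  set M : ℝ := (n : ℝ) + 2
  linear_combination
    (-30 * M ^ 2 + 30 * M) * hu 0
    + ((30 * M ^ 2 - 30 * M) * t) * hu 1
    + ((-12 * M ^ 2 + 21 * M + 3) * t ^ 2 + 60 * M + 60) * hu 2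
    + ((2 * M ^ 2 - 11 * M - 3) * t ^ 3 + (-60 * M - 60) * t) * hu 3
    + (3 * M * t ^ 4 + (24 * M + 15) * t ^ 2 - 30) * hu 4
    + (t ^ 5 + (-4 * M + 5) * t ^ 3 + 30 * t) * hu 5
    + (-3 * t ^ 4 - 12 * t ^ 2) * hu 6
    + (2 * t ^ 3) * hu 7
    + ((-6 * M - 6) * t ^ 2 - 120) * hv 1
    + ((6 * M + 6) * t ^ 3 + 120 * t) * hv 2
    + ((-2 * M - 1) * t ^ 4 - 42 * t ^ 2) * hv 3
    + (-t ^ 5 + 2 * t ^ 3) * hv 4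
    + (2 * t ^ 4) * hv 5
    + (30 * M) * hw 0
    + (-30 * M * t) * hw 1
    + ((12 * M - 3) * t ^ 2 - 30) * hw 2
    + ((-2 * M + 3) * t ^ 3 + 30 * t) * hw 3
    + (-t ^ 4 - 12 * t ^ 2) * hw 4
    + (2 * t ^ 3) * hw 5
end

section
/- (Integral representation of the elliptic GinUE part of the MGF.) For every τ ∈ [0,1], every even integer N ≥ 2 and every real t ≠ 0, u(t) = (2/((1+τ)(N−2)!)) · ∫_ℝ (e^{tx}/t) · C_{N−2}(x) · C_{N−1}(x) · (e^{−x²/(1+τ)}/√(2π)) dx. -/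
open Real MeasureTheory Finset

open Polynomial in
/-- Each `CH τ k` is a polynomial function. -/
theorem CH_eq_eval (τ : ℝ) (k : ℕ) : ∃ p : ℝ[X], ∀ x, CH τ k x = p.eval x := by
  induction k using Nat.twoStepInduction with
  | zero => exact ⟨1, fun x => by simp [CH]⟩
  | one => exact ⟨X, fun x => by simp [CH]⟩
  | more k ih₀ ih₁ =>
    obtain ⟨p, hp⟩ := ih₀
    obtain ⟨q, hq⟩ := ih₁
    exact ⟨X * q - C (((k : ℝ) + 1) * τ) * p, fun x => by simp [CH, hp, hq]⟩

/-- The Appell property of the rescaled Hermite polynomials. -/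
theorem hasDerivAt_CH_succ (τ : ℝ) (k : ℕ) (x : ℝ) :
    HasDerivAt (CH τ (k + 1)) (((k : ℝ) + 1) * CH τ k x) x := by
  induction k using Nat.twoStepInduction with
  | zero => exact (hasDerivAt_id x).congr_deriv (by simp [CH])
  | one =>
    refine (((hasDerivAt_id x).mul (hasDerivAt_id x)).sub_const
      ((((0 : ℕ) : ℝ) + 1) * τ * 1)).congr_deriv ?_
    simp only [CH, id]
    push_cast
    ring
  | more k ih₀ ih₁ =>
    refine (((hasDerivAt_id x).mul ih₁).sub
      (ih₀.const_mul ((((k + 1 : ℕ) : ℝ) + 1) * τ))).congr_deriv ?_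
    simp only [CH, id]
    push_cast
    ring

/-- Christoffel–Darboux-type telescoping for the weighted sum of squares. -/
theorem hasDerivAt_exp_mul_sum_CH_sq {τ : ℝ} (hτ : 1 + τ ≠ 0) (n : ℕ) (x : ℝ) :
    HasDerivAt
      (fun y => Real.exp (-y ^ 2 / (1 + τ)) *
        ∑ k ∈ Finset.range (n + 1), (CH τ k y) ^ 2 / (Nat.factorial k : ℝ))
      (-(2 / ((1 + τ) * (Nat.factorial n : ℝ))) *
        (CH τ n x * CH τ (n + 1) x * Real.exp (-x ^ 2 / (1 + τ)))) x := by
  have hw : HasDerivAt (fun y : ℝ => Real.exp (-y ^ 2 / (1 + τ)))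
      (Real.exp (-x ^ 2 / (1 + τ)) * (-(2 * x) / (1 + τ))) x := by
    simpa using (((hasDerivAt_id x).pow 2).neg.div_const (1 + τ)).exp
  induction n with
  | zero =>
    simp only [zero_add, Finset.sum_range_one, CH, Nat.factorial_zero, Nat.cast_one, one_pow,
      div_one, mul_one, one_mul]
    exact hw.congr_deriv (by ring)
  | succ n ih =>
    have h := ih.fun_add (hw.fun_mul (((hasDerivAt_CH_succ τ n x).fun_pow 2).div_const
      (Nat.factorial (n + 1) : ℝ)))
    have hf : (Nat.factorial n : ℝ) ≠ 0 := by positivity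
    have hn : (n : ℝ) + 1 ≠ 0 := by positivity
    simp only [Finset.sum_range_succ _ (n + 1), mul_add]
    refine h.congr_deriv ?_
    simp only [CH, Nat.factorial_succ]
    push_cast
    field_simp
    ring

open Polynomial in
theorem integrable_eval_mul_exp_neg_mul_sq (p : ℝ[X]) {b : ℝ} (hb : 0 < b) :
    Integrable fun x : ℝ => p.eval x * Real.exp (-b * x ^ 2) := by
  induction p using Polynomial.induction_on' with
  | add p q hp hq => simpa [add_mul] using! hp.add hq
  | monomial n a =>
    have h := (integrable_rpow_mul_exp_neg_mul_sq hb (s := n)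
      (by linarith [n.cast_nonneg (α := ℝ)])).const_mul a
    simpa [mul_assoc] using h

open Polynomial in
theorem integrable_exp_mul_eval_mul_exp_neg_sq_div (p : ℝ[X]) {c : ℝ} (hc : 0 < c) (t : ℝ) :
    Integrable fun x : ℝ => Real.exp (t * x) * (p.eval x * Real.exp (-x ^ 2 / c)) := by
  have h := ((integrable_eval_mul_exp_neg_mul_sq (p.comp (X + C (c * t / 2)))
    (inv_pos.mpr hc)).comp_sub_right (c * t / 2)).const_mul (Real.exp (c * t ^ 2 / 4))
  refine h.congr (Filter.Eventually.of_forall fun x => ?_)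
  have he : Real.exp (c * t ^ 2 / 4) * Real.exp (-c⁻¹ * (x - c * t / 2) ^ 2) =
      Real.exp (t * x) * Real.exp (-x ^ 2 / c) := by
    rw [← Real.exp_add, ← Real.exp_add]
    congr 1
    field_simp
    ring
  simp only [eval_comp, eval_add, eval_X, eval_C, sub_add_cancel]
  linear_combination p.eval x * he

/-- **Theorem (Integral representation of the elliptic GinUE part of the MGF).**
For every `τ ∈ [0,1]`, every even integer `N ≥ 2` and every real `t ≠ 0`,
`u(t) = (2/((1+τ)(N−2)!)) ∫_ℝ (e^{tx}/t)·C_{N−2}(x)·C_{N−1}(x)·(e^{−x²/(1+τ)}/√(2π)) dx`. -/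
theorem u_integral_representation (τ : ℝ) (hτ : τ ∈ Set.Icc (0:ℝ) 1)
    (N : ℕ) (hNeven : Even N) (hN2 : 2 ≤ N) (t : ℝ) (ht : t ≠ 0) :
    uF τ N t = (2/((1+τ) * (Nat.factorial (N-2) : ℝ))) *
      ∫ x : ℝ, (Real.exp (t*x)/t) * CH τ (N-2) x * CH τ (N-1) x *
        (Real.exp (-x^2/(1+τ)) / Real.sqrt (2*Real.pi)) := by
  obtain ⟨n, rfl⟩ : ∃ n, N = n + 2 := ⟨N - 2, by omega⟩
  have hc : 0 < 1 + τ := by linarith [hτ.1]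
  simp only [Nat.add_sub_cancel, show n + 2 - 1 = n + 1 by omega]
  choose P hP using CH_eq_eval τ
  set f : ℝ → ℝ := fun y => Real.exp (-y ^ 2 / (1 + τ)) *
    ∑ k ∈ Finset.range (n + 1), (CH τ k y) ^ 2 / (Nat.factorial k : ℝ) with hf
  set f' : ℝ → ℝ := fun x => -(2 / ((1 + τ) * (Nat.factorial n : ℝ))) *
    (CH τ n x * CH τ (n + 1) x * Real.exp (-x ^ 2 / (1 + τ))) with hf'
  have h_int : Integrable fun x : ℝ => Real.exp (t * x) * f x := by
    have h := integrable_exp_mul_eval_mul_exp_neg_sq_div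
      (∑ k ∈ Finset.range (n + 1), Polynomial.C ((Nat.factorial k : ℝ)⁻¹) * P k ^ 2) hc t
    refine h.congr (Filter.Eventually.of_forall fun x => ?_)
    simp only [hf, hP, Polynomial.eval_finsetSum, Polynomial.eval_mul, Polynomial.eval_C,
      Polynomial.eval_pow]
    rw [mul_comm (Finset.sum _ _)]
    simp only [div_eq_inv_mul]
  have h_int_deriv : Integrable fun x : ℝ => Real.exp (t * x) * f' x := by
    have h := (integrable_exp_mul_eval_mul_exp_neg_sq_div (P n * P (n + 1)) hc t).const_mul
      (-(2 / ((1 + τ) * (Nat.factorial n : ℝ))))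
    refine h.congr (Filter.Eventually.of_forall fun x => ?_)
    simp only [hf', hP, Polynomial.eval_mul]
    ring
  have hexp : ∀ x : ℝ, HasDerivAt (fun y => Real.exp (t * y)) (t * Real.exp (t * x)) x := by
    intro x
    simpa [mul_comm] using ((hasDerivAt_id x).const_mul t).exp
  have h_int_exp_deriv : Integrable fun x : ℝ => t * Real.exp (t * x) * f x := by
    simpa only [mul_assoc] using h_int.const_mul t
  have hparts := integral_mul_deriv_eq_deriv_mul_of_integrable
    (fun x _ => hexp x) (fun x _ => hasDerivAt_exp_mul_sum_CH_sq hc.ne' n x) h_int_deriv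
    h_int_exp_deriv h_int
  have hu : uF τ (n + 2) t = (Real.sqrt (2 * Real.pi))⁻¹ * ∫ x : ℝ, Real.exp (t * x) * f x := by
    rw [uF, ← integral_const_mul]
    congr 1 with x
    simp only [R1, hf, show n + 2 - 1 = n + 1 by omega]
    ring
  have hmul : ∫ x : ℝ, t * Real.exp (t * x) * f x = t * ∫ x : ℝ, Real.exp (t * x) * f x := by
    simp only [mul_assoc, integral_const_mul]
  rw [hmul] at hparts
  have hI : ∫ x : ℝ, Real.exp (t * x) * f x = -t⁻¹ * ∫ x : ℝ, Real.exp (t * x) * f' x := by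
    rw [hparts]
    field_simp
  rw [hu, hI, ← integral_const_mul, ← integral_const_mul, ← integral_const_mul]
  congr 1 with x
  simp only [hf']
  ring
end

section
/- (Discrete representation of the elliptic GinUE part of the MGF.) For every τ ∈ [0,1], every even integer N ≥ 2 and every real t ≠ 0, u(t) = √(2/(1+τ)) · e^{(1+τ)t²/4} · (1/t) · Σ_{k=0}^{N−2} (1/k!) · binom(N−1, k+1) · τ^{N−k−2} · P_{2k+1}^{(s)}((1+τ)t/2), where s = (τ−1)/2. -/
open Real MeasureTheory Finset

open Polynomial in
/-- The polynomial whose evaluation is `CH τ k`. -/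
noncomputable def hermitePoly (τ : ℝ) : ℕ → ℝ[X]
  | 0 => 1
  | 1 => X
  | (k+2) => X * hermitePoly τ (k+1) - C (((k : ℝ) + 1) * τ) * hermitePoly τ k

open Polynomial in
lemma eval_hermitePoly (τ x : ℝ) (k : ℕ) : (hermitePoly τ k).eval x = CH τ k x := by
  induction k using Nat.twoStepInduction with
  | zero => simp [hermitePoly, CH]
  | one => simp [hermitePoly, CH]
  | more k h0 h1 => simp [hermitePoly, CH, h0, h1]

open Polynomial in
lemma hermitePoly_succ (τ : ℝ) (k : ℕ) :
    hermitePoly τ (k+1) = X * hermitePoly τ k - C ((k : ℝ) * τ) * hermitePoly τ (k-1) := by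
  cases k <;> simp [hermitePoly]

open Polynomial in
lemma derivative_hermitePoly (τ : ℝ) (k : ℕ) :
    derivative (hermitePoly τ k) = C (k : ℝ) * hermitePoly τ (k-1) := by
  induction k using Nat.twoStepInduction with
  | zero => simp [hermitePoly]
  | one => simp [hermitePoly]
  | more k h0 h1 =>
    have h := hermitePoly_succ τ k
    simp only [hermitePoly, derivative_sub, derivative_mul, derivative_X, derivative_C, h0, h1,
      Nat.add_sub_cancel, show k + 2 - 1 = k + 1 from rfl]
    simp only [Nat.cast_add, Nat.cast_one, Nat.cast_ofNat, C_add, C_mul, C_1, map_ofNat] at h ⊢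
    linear_combination (-1 - C (k:ℝ)) * h

/-- The linearization coefficients satisfy the recursion coming from the three-term recursion. -/
lemma linearization_coeff_succ (m n j : ℕ) :
    ((m+1).choose (j+1) * n.choose (j+1) * (j+1).factorial : ℝ) =
      m.choose (j+1) * (n+1).choose (j+1) * (j+1).factorial
        + n * (m.choose j * (n-1).choose j * j.factorial)
        - m * ((m-1).choose j * n.choose j * j.factorial) := by
  have key : ∀ n : ℕ, (n * (n-1).choose j : ℝ) = (j+1) * n.choose (j+1) := by
    intro n
    cases n with
    | zero => simp
    | succ n =>
      have := Nat.add_one_mul_choose_eq n j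
      rw [Nat.add_sub_cancel, mul_comm ((j:ℝ)+1)]
      exact_mod_cast this
  have hm := key m
  have hn := key n
  rw [Nat.choose_succ_succ m j, Nat.choose_succ_succ n j, Nat.factorial_succ]
  push_cast
  linear_combination (-(m.choose j * j.factorial : ℝ)) * hn + (n.choose j * j.factorial : ℝ) * hm

open Polynomial in
/-- Linearization of products of Hermite polynomials. -/
lemma hermitePoly_mul (τ : ℝ) (m n J : ℕ) (hJ : m ≤ J) :
    hermitePoly τ m * hermitePoly τ n = ∑ j ∈ range (J+1),
      C ((m.choose j * n.choose j * j.factorial : ℝ) * τ^j) * hermitePoly τ (m+n-2*j) := by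
  induction m using Nat.strong_induction_on generalizing n J with
  | _ m ih =>
  cases m with
  | zero =>
    rw [sum_range_succ']
    simp [hermitePoly]
  | succ m =>
    obtain ⟨J, rfl⟩ : ∃ J', J = J' + 1 := ⟨J - 1, by omega⟩
    have h1 := ih m (by omega) (n+1) (J+1) (by omega)
    have h2 := ih m (by omega) (n-1) J (by omega)
    have h3 := ih (m-1) (by omega) n J (by omega)
    have e : hermitePoly τ (m+1) * hermitePoly τ n = hermitePoly τ m * hermitePoly τ (n+1)
        + C (n * τ) * (hermitePoly τ m * hermitePoly τ (n-1))
        - C (m * τ) * (hermitePoly τ (m-1) * hermitePoly τ n) := by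
      rw [hermitePoly_succ τ m, hermitePoly_succ τ n]; ring
    rw [e, h1, h2, h3, sum_range_succ', sum_range_succ' _ (J+1), mul_sum, mul_sum,
      add_right_comm, add_sub_right_comm, ← sum_add_distrib, ← sum_sub_distrib]
    congr 1
    · refine sum_congr rfl fun j _ => ?_
      have i2 : C ((n:ℝ) * τ) * (C ((m.choose j * (n-1).choose j * j.factorial : ℝ) * τ^j)
          * hermitePoly τ (m+(n-1)-2*j)) = C ((n:ℝ) * τ) *
          (C ((m.choose j * (n-1).choose j * j.factorial : ℝ) * τ^j)
          * hermitePoly τ (m+1+n-2*(j+1))) := by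
        cases n with
        | zero => simp
        | succ n => congr 3; omega
      have i3 : C ((m:ℝ) * τ) * (C (((m-1).choose j * n.choose j * j.factorial : ℝ) * τ^j)
          * hermitePoly τ (m-1+n-2*j)) = C ((m:ℝ) * τ) *
          (C (((m-1).choose j * n.choose j * j.factorial : ℝ) * τ^j)
          * hermitePoly τ (m+1+n-2*(j+1))) := by
        cases m with
        | zero => simp
        | succ m => congr 3; omega
      rw [i2, i3, linearization_coeff_succ, show m + (n+1) = m+1+n by omega]
      simp only [C_add, C_sub, C_mul, C_pow]
      ring
    · simp [show m + (n+1) = m+1+n by omega]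

open Polynomial in
/-- The Christoffel–Darboux type identity `x S - ((1+τ)/2) S' = C_{K+1} C_K / K!` for
`S = ∑_{k ≤ K} C_k² / k!`. -/
lemma hermitePoly_sum_sq (τ : ℝ) (K : ℕ) :
    X * (∑ k ∈ range (K+1), C (1/(k.factorial : ℝ)) * hermitePoly τ k ^ 2)
      - C ((1+τ)/2) * derivative (∑ k ∈ range (K+1), C (1/(k.factorial : ℝ)) * hermitePoly τ k ^ 2)
      = C (1/(K.factorial : ℝ)) * (hermitePoly τ (K+1) * hermitePoly τ K) := by
  induction K with
  | zero => simp [hermitePoly]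
  | succ K ih =>
    rw [sum_range_succ, mul_add, derivative_add, mul_add, add_sub_add_comm, ih,
      hermitePoly_succ τ (K+1), derivative_mul, derivative_pow, derivative_hermitePoly,
      derivative_C, Nat.add_sub_cancel]
    have hf : C (1/(K.factorial : ℝ)) = C (1/((K+1).factorial : ℝ)) * C ((K+1 : ℕ) : ℝ) := by
      rw [← C_mul, Nat.factorial_succ]
      congr 1
      push_cast
      field_simp
    have h2 : (C ((1+τ)/2) : ℝ[X]) * C 2 = 1 + C τ := by
      rw [← C_mul, ← C_1, ← C_add]; congr 1; ring
    rw [hf, C_mul]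
    simp only [Nat.cast_ofNat, Nat.add_one_sub_one, pow_one, zero_mul, zero_add]
    linear_combination (-(C (1/((K+1).factorial : ℝ)) * C ((K+1 : ℕ) : ℝ) * hermitePoly τ (K+1)
      * hermitePoly τ K)) * h2

open Polynomial in
lemma integrable_polynomial_mul_gaussian {b : ℝ} (hb : 0 < b) (p : ℝ[X]) :
    Integrable fun x : ℝ => p.eval x * exp (-b * x^2) := by
  induction p using Polynomial.induction_on' with
  | add p q hp hq =>
    simp only [eval_add, add_mul]
    exact hp.add hq
  | monomial n c =>
    have := integrable_rpow_mul_exp_neg_mul_sq hb (s := n)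
      (by have : (0:ℝ) ≤ n := n.cast_nonneg
          linarith)
    simpa [eval_monomial, mul_assoc] using this.const_mul c

lemma exp_quadratic_eq_shift {a : ℝ} (ha : 0 < a) (t x : ℝ) :
    exp (t*x - x^2/(2*a)) = exp (a*t^2/2) * exp (-(1/(2*a)) * (x - a*t)^2) := by
  rw [← exp_add]
  congr 1
  field_simp
  ring

open Polynomial in
lemma integrable_polynomial_mul_exp_quadratic {a : ℝ} (ha : 0 < a) (t : ℝ) (p : ℝ[X]) :
    Integrable fun x : ℝ => p.eval x * exp (t*x - x^2/(2*a)) := by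
  have h := ((integrable_polynomial_mul_gaussian (b := 1/(2*a)) (by positivity)
    (p.comp (X + C (a*t)))).comp_sub_right (a*t)).const_mul (exp (a*t^2/2))
  refine h.congr (Filter.Eventually.of_forall fun x => ?_)
  simp only [exp_quadratic_eq_shift ha t x, eval_comp, eval_add, eval_X, eval_C, sub_add_cancel]
  ring

lemma integral_exp_quadratic {a : ℝ} (ha : 0 < a) (t : ℝ) :
    ∫ x : ℝ, exp (t*x - x^2/(2*a)) = exp (a*t^2/2) * √(2*π*a) := by
  simp_rw [exp_quadratic_eq_shift ha t]
  rw [integral_const_mul, integral_sub_right_eq_self (fun x => exp (-(1/(2*a)) * x^2)) (a*t),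
    integral_gaussian]
  congr 2
  field_simp

open Polynomial in
/-- Integration of polynomials against the weight `exp (t x - x² / (2 a))`. -/
noncomputable def gaussianFunctional {a : ℝ} (ha : 0 < a) (t : ℝ) : ℝ[X] →ₗ[ℝ] ℝ where
  toFun p := ∫ x : ℝ, p.eval x * exp (t*x - x^2/(2*a))
  map_add' p q := by
    simp only [eval_add, add_mul]
    exact integral_add (integrable_polynomial_mul_exp_quadratic ha t p)
      (integrable_polynomial_mul_exp_quadratic ha t q)
  map_smul' c p := by
    simp only [eval_smul, smul_eq_mul, mul_assoc, RingHom.id_apply]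
    exact integral_const_mul c _

open Polynomial in
lemma gaussianFunctional_C_mul {a : ℝ} (ha : 0 < a) (t c : ℝ) (p : ℝ[X]) :
    gaussianFunctional ha t (C c * p) = c * gaussianFunctional ha t p := by
  rw [← smul_eq_C_mul, map_smul, smul_eq_mul]

open Polynomial in
/-- Gaussian integration by parts. -/
lemma gaussianFunctional_X_mul {a : ℝ} (ha : 0 < a) (t : ℝ) (p : ℝ[X]) :
    gaussianFunctional ha t (X * p) =
      a * t * gaussianFunctional ha t p + a * gaussianFunctional ha t (derivative p) := by
  have h0 : gaussianFunctional ha t (derivative p + C t * p - C (1/a) * (X * p)) = 0 := by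
    refine integral_eq_zero_of_hasDerivAt_of_integrable
      (f := fun x => p.eval x * exp (t*x - x^2/(2*a))) (fun x => ?_)
      (integrable_polynomial_mul_exp_quadratic ha t _)
      (integrable_polynomial_mul_exp_quadratic ha t p)
    have hq : HasDerivAt (fun x : ℝ => t*x - x^2/(2*a)) (t - x/a) x := by
      have := ((hasDerivAt_id x).const_mul t).sub ((hasDerivAt_pow 2 x).div_const (2*a))
      refine this.congr_deriv ?_
      norm_num
      field_simp
    refine ((p.hasDerivAt x).mul hq.exp).congr_deriv ?_
    simp only [eval_sub, eval_add, eval_mul, eval_C, eval_X]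
    ring
  rw [map_sub, map_add, gaussianFunctional_C_mul, gaussianFunctional_C_mul] at h0
  field_simp at h0
  linarith

open Polynomial in
/-- Gaussian averaging of variance `a` shifts the Hermite parameter from `τ` to `τ - a`. -/
lemma gaussianFunctional_hermitePoly {a : ℝ} (ha : 0 < a) (t τ : ℝ) (m : ℕ) :
    gaussianFunctional ha t (hermitePoly τ m) =
      CH (τ - a) m (a*t) * gaussianFunctional ha t 1 := by
  induction m using Nat.twoStepInduction with
  | zero => simp [hermitePoly, CH]
  | one =>
    have := gaussianFunctional_X_mul ha t 1
    simpa [hermitePoly, CH] using this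
  | more k h0 h1 =>
    simp only [hermitePoly, CH]
    rw [map_sub, gaussianFunctional_X_mul, derivative_hermitePoly, gaussianFunctional_C_mul,
      gaussianFunctional_C_mul, Nat.add_sub_cancel, h0, h1]
    push_cast
    ring

lemma gaussianFunctional_one {a : ℝ} (ha : 0 < a) (t : ℝ) :
    gaussianFunctional ha t 1 = exp (a*t^2/2) * √(2*π*a) := by
  rw [← integral_exp_quadratic ha t]
  simp [gaussianFunctional]

open Polynomial in
lemma uF_eq_gaussianFunctional {τ : ℝ} (ha : 0 < (1+τ)/2) (N : ℕ) (t : ℝ) :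
    uF τ N t = 1/√(2*π) * gaussianFunctional ha t
      (∑ k ∈ range (N-1), C (1/(k.factorial : ℝ)) * hermitePoly τ k ^ 2) := by
  change _ = 1/√(2*π) * ∫ x : ℝ, _
  rw [uF, ← integral_const_mul]
  congr 1
  funext x
  simp only [R1, eval_finsetSum, eval_mul, eval_C, eval_pow, eval_hermitePoly]
  rw [sub_eq_add_neg (t*x), exp_add, show -(x^2/(2*((1+τ)/2))) = -x^2/(1+τ) by
    rw [mul_div_cancel₀ _ (two_ne_zero), neg_div]]
  simp only [div_eq_inv_mul, mul_one]
  ring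

open Polynomial in
lemma gaussianFunctional_hermitePoly_mul_succ {a : ℝ} (ha : 0 < a) (t τ : ℝ) (K : ℕ) :
    1/(K.factorial : ℝ) * gaussianFunctional ha t (hermitePoly τ (K+1) * hermitePoly τ K) =
      gaussianFunctional ha t 1 * ∑ k ∈ range (K+1),
        (1/(k.factorial : ℝ)) * ((K+1).choose (k+1) : ℝ) * τ^(K-k) *
          CH (τ - a) (2*k+1) (a*t) := by
  rw [mul_comm (hermitePoly τ (K+1)), hermitePoly_mul τ K (K+1) K le_rfl, map_sum, mul_sum,
    mul_sum, ← sum_range_reflect]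
  refine sum_congr rfl fun k hk => ?_
  have hk : k ≤ K := Nat.lt_succ_iff.mp (mem_range.mp hk)
  rw [gaussianFunctional_C_mul, gaussianFunctional_hermitePoly, show K + 1 - 1 - k = K - k by omega,
    show K + (K+1) - 2*(K-k) = 2*k+1 by omega, Nat.choose_symm hk,
    Nat.choose_symm_of_eq_add (show K + 1 = (K-k) + (k+1) by omega)]
  have h : (K.choose k * k.factorial * (K-k).factorial : ℝ) = K.factorial := by
    exact_mod_cast Nat.choose_mul_factorial_mul_factorial hk
  rw [← h]
  have h1 : (K.choose k : ℝ) ≠ 0 := by exact_mod_cast (Nat.choose_pos hk).ne'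
  have h2 : ((K-k).factorial : ℝ) ≠ 0 := by positivity
  field_simp

/-- **Theorem (Discrete representation of the elliptic GinUE part of the MGF).**
For every `τ ∈ [0,1]`, every even integer `N ≥ 2` and every real `t ≠ 0`,
`u(t) = √(2/(1+τ))·e^{(1+τ)t²/4}·(1/t)·Σ_{k=0}^{N−2} (1/k!)·binom(N−1,k+1)·τ^{N−k−2}·
P_{2k+1}^{(s)}((1+τ)t/2)` with `s = (τ−1)/2`; here `P_m^{(s)} = CH s m` satisfies the
same three-term recursion as the rescaled Hermite polynomials, with parameter `s`. -/
theorem u_discrete_representation (τ : ℝ) (hτ : τ ∈ Set.Icc (0:ℝ) 1)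
    (N : ℕ) (hNeven : Even N) (hN2 : 2 ≤ N) (t : ℝ) (ht : t ≠ 0) :
    uF τ N t = Real.sqrt (2/(1+τ)) * Real.exp ((1+τ)*t^2/4) * (1/t) *
      ∑ k ∈ Finset.range (N-1),
        (1/(Nat.factorial k : ℝ)) * (Nat.choose (N-1) (k+1) : ℝ) * τ^(N-k-2) *
          CH ((τ-1)/2) (2*k+1) ((1+τ)*t/2) := by
  obtain ⟨K, rfl⟩ : ∃ K, N = K + 2 := ⟨N - 2, by omega⟩
  have ha : 0 < (1+τ)/2 := by linarith [hτ.1]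
  have hcd := congrArg (gaussianFunctional ha t) (hermitePoly_sum_sq τ K)
  rw [map_sub, gaussianFunctional_X_mul, gaussianFunctional_C_mul, gaussianFunctional_C_mul,
    gaussianFunctional_hermitePoly_mul_succ, gaussianFunctional_one, add_sub_cancel_right] at hcd
  rw [uF_eq_gaussianFunctional ha, show K + 2 - 1 = K + 1 from rfl]
  have hsum : ∑ k ∈ range (K+1), (1/(k.factorial : ℝ)) * ((K+1).choose (k+1) : ℝ) * τ^(K+2-k-2) *
      CH ((τ-1)/2) (2*k+1) ((1+τ)*t/2) = ∑ k ∈ range (K+1), (1/(k.factorial : ℝ)) *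
      ((K+1).choose (k+1) : ℝ) * τ^(K-k) * CH (τ - (1+τ)/2) (2*k+1) ((1+τ)/2*t) := by
    refine sum_congr rfl fun k _ => ?_
    rw [show K + 2 - k - 2 = K - k by omega, show (τ-1)/2 = τ - (1+τ)/2 by ring,
      show (1+τ)*t/2 = (1+τ)/2*t by ring]
  rw [hsum, show (1+τ)*t^2/4 = (1+τ)/2*t^2/2 by ring,
    show 2/(1+τ) = ((1+τ)/2)⁻¹ by rw [inv_div]]
  generalize (1+τ)/2 = a at *
  rw [sqrt_mul (by positivity) a] at hcd
  rw [sqrt_inv]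
  have hs : √(2*π) ≠ 0 := by positivity
  have hsa : √a ≠ 0 := by positivity
  have hsq : √a * √a = a := mul_self_sqrt ha.le
  have hat : a * t ≠ 0 := mul_ne_zero ha.ne' ht
  refine mul_left_cancel₀ hat ?_
  rw [mul_left_comm, hcd]
  generalize ∑ k ∈ range (K+1), (_ : ℝ) = S
  field_simp
  linear_combination S * hsq
end

section
/- (Third-order differential equation for the elliptic GinUE part of the MGF.) For every τ ∈ [0,1] and every even integer N ≥ 2, the function u satisfies a_3(t)u‴(t) + a_2(t)u″(t) + a_1(t)u′(t) + a_0(t)u(t) = 0 for all real t ≠ 0, where a_3(t) = (1−τ)/2, a_2(t) = −((1−4τ+τ²)(1+τ)/4)t + (1−τ)/t, a_1(t) = −(1+τ)[ (3τ(1−τ²)/8)t² + ((1−τ²)/2)(N−1) + (1−5τ+τ²)/2 ] − (1−τ)/t², and a_0(t) = −[ (τ²(1+τ)/8)t² + (τ(1+τ)/2)(N−1) + 5τ(1−τ)/8 ]·(1+τ)²·t. -/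
open Real MeasureTheory Finset

open Polynomial NNReal ProbabilityTheory

/-- A polynomial times an exponential is integrable for a Gaussian measure. -/
lemma integrable_eval_mul_exp_gaussianReal (v : ℝ≥0) (t : ℝ) (P : ℝ[X]) :
    Integrable (fun x => P.eval x * Real.exp (t * x)) (gaussianReal 0 v) := by
  induction P using Polynomial.induction_on' with
  | add p q hp hq => simpa only [eval_add, add_mul] using hp.fun_add hq
  | monomial n a =>
    have h := (integrable_pow_mul_exp_of_mem_interior_integrableExpSet (X := id)
      (μ := gaussianReal 0 v) (v := t) (by simp) n).const_mul a
    simpa [mul_assoc] using h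

/-- The exponentially tilted Gaussian expectation `P ↦ E[P(Z) exp (t Z)]` for `Z ~ N(0, v)`. -/
noncomputable def tiltedGaussian (v : ℝ≥0) (t : ℝ) : ℝ[X] →ₗ[ℝ] ℝ where
  toFun P := ∫ x, P.eval x * Real.exp (t * x) ∂gaussianReal 0 v
  map_add' P Q := by
    simp only [eval_add, add_mul]
    exact integral_add (integrable_eval_mul_exp_gaussianReal v t P)
      (integrable_eval_mul_exp_gaussianReal v t Q)
  map_smul' a P := by
    simp only [eval_smul, smul_eq_mul, mul_assoc, RingHom.id_apply]
    exact integral_const_mul _ _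

lemma tiltedGaussian_apply (v : ℝ≥0) (t : ℝ) (P : ℝ[X]) :
    tiltedGaussian v t P = ∫ x, P.eval x * Real.exp (t * x) ∂gaussianReal 0 v := rfl

/-- Differentiating in the tilt inserts a factor `X`. -/
lemma hasDerivAt_tiltedGaussian (v : ℝ≥0) (P : ℝ[X]) (t : ℝ) :
    HasDerivAt (fun s => tiltedGaussian v s P) (tiltedGaussian v t (X * P)) t := by
  induction P using Polynomial.induction_on' with
  | add p q hp hq => simpa only [mul_add, map_add] using hp.fun_add hq
  | monomial n a =>
    have h := (hasDerivAt_integral_pow_mul_exp_real (X := id)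
      (μ := gaussianReal 0 v) (t := t) (by simp) n).const_mul a
    simpa [tiltedGaussian_apply, X_mul_monomial, mul_assoc, integral_const_mul] using h

lemma deriv_tiltedGaussian (v : ℝ≥0) (P : ℝ[X]) :
    deriv (fun s => tiltedGaussian v s P) = fun s => tiltedGaussian v s (X * P) :=
  funext fun t => (hasDerivAt_tiltedGaussian v P t).deriv

lemma iteratedDeriv_tiltedGaussian (v : ℝ≥0) (P : ℝ[X]) (k : ℕ) :
    iteratedDeriv k (fun s => tiltedGaussian v s P)
      = fun s => tiltedGaussian v s (X ^ k * P) := by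
  induction k with
  | zero => simp
  | succ k ih => rw [iteratedDeriv_succ, ih, deriv_tiltedGaussian]; simp only [pow_succ', mul_assoc]

/-- Gaussian integration by parts for polynomials times exponentials. -/
lemma tiltedGaussian_X_mul (v : ℝ≥0) (t : ℝ) (P : ℝ[X]) :
    tiltedGaussian v t (X * P)
      = v * (tiltedGaussian v t (derivative P) + t * tiltedGaussian v t P) := by
  induction P using Polynomial.induction_on generalizing t with
  | C a =>
    have h1 : ∀ s, tiltedGaussian v s (C a) = a * Real.exp (v * s ^ 2 / 2) := by
      intro s
      have h := congrFun (mgf_id_gaussianReal (μ := 0) (v := v)) s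
      simp only [mgf, id_eq, zero_mul, zero_add] at h
      simp [tiltedGaussian_apply, integral_const_mul, h]
    have h2 := hasDerivAt_tiltedGaussian v (C a) t
    simp only [h1] at h2
    have h3 : HasDerivAt (fun s : ℝ => a * Real.exp (v * s ^ 2 / 2))
        (a * (Real.exp (v * t ^ 2 / 2) * (v * (2 * t) / 2))) t := by
      have := ((((hasDerivAt_id t).fun_pow 2).const_mul (v : ℝ)).div_const 2).exp.const_mul a
      simpa using this
    rw [h2.unique h3, h1]
    simp
    ring
  | add p q hp hq => simp only [mul_add, map_add, hp, hq]; ring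
  | monomial n a ih =>
    have hX : C a * X ^ (n + 1) = X * (C a * X ^ n) := by ring
    rw [hX]
    generalize C a * X ^ n = P at ih
    have h1 := hasDerivAt_tiltedGaussian v (X * P) t
    simp only [ih] at h1
    have h2 := ((hasDerivAt_tiltedGaussian v (derivative P) t).fun_add
      ((hasDerivAt_id t).fun_mul (hasDerivAt_tiltedGaussian v P t))).const_mul (v : ℝ)
    rw [h1.unique h2]
    simp only [derivative_mul, derivative_X, one_mul, map_add, id_eq]
    ring

/-- Gaussian integration by parts against a monomial multiple. -/
lemma tiltedGaussian_X_pow_succ_mul (v : ℝ≥0) (t : ℝ) (k : ℕ) (P : ℝ[X]) :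
    tiltedGaussian v t (X ^ (k + 1) * P)
      = v * (k * tiltedGaussian v t (X ^ (k - 1) * P)
        + tiltedGaussian v t (X ^ k * derivative P) + t * tiltedGaussian v t (X ^ k * P)) := by
  have h : derivative (X ^ k * P) = (k : ℝ) • (X ^ (k - 1) * P) + X ^ k * derivative P := by
    rw [derivative_mul, derivative_X_pow, smul_eq_C_mul]; ring
  rw [pow_succ', mul_assoc, tiltedGaussian_X_mul, h]
  simp

/-- The polynomials whose evaluations are `CH τ k`. -/
noncomputable def scaledHermite (τ : ℝ) : ℕ → ℝ[X]
  | 0 => 1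
  | 1 => X
  | (k + 2) => X * scaledHermite τ (k + 1) - C (((k : ℝ) + 1) * τ) * scaledHermite τ k

lemma eval_scaledHermite (τ : ℝ) (x : ℝ) : ∀ k, (scaledHermite τ k).eval x = CH τ k x
  | 0 => by simp [scaledHermite, CH]
  | 1 => by simp [scaledHermite, CH]
  | (k + 2) => by
    simp [scaledHermite, CH, eval_scaledHermite τ x k, eval_scaledHermite τ x (k + 1)]

lemma derivative_scaledHermite_succ (τ : ℝ) : ∀ k : ℕ,
    derivative (scaledHermite τ (k + 1)) = C ((k : ℝ) + 1) * scaledHermite τ k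
  | 0 => by simp [scaledHermite]
  | 1 => by
    simp [scaledHermite]
    ring
  | (k + 2) => by
    rw [scaledHermite, derivative_sub, derivative_mul, derivative_X, derivative_C_mul,
      derivative_scaledHermite_succ τ (k + 1), derivative_scaledHermite_succ τ k]
    simp only [scaledHermite, map_add, map_mul, map_one, Nat.cast_add, Nat.cast_ofNat,
      Nat.cast_one, map_ofNat]
    ring

/-- The lowering relation solved for the next polynomial. -/
lemma smul_derivative_scaledHermite (τ : ℝ) (k : ℕ) :
    τ • derivative (scaledHermite τ k) = X * scaledHermite τ k - scaledHermite τ (k + 1) := by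
  cases k with
  | zero => simp [scaledHermite]
  | succ k =>
    rw [derivative_scaledHermite_succ, scaledHermite, smul_eq_C_mul, map_mul]
    ring

/-- The diagonal Hermite kernel with `n` terms. -/
noncomputable def hermiteKernel (τ : ℝ) (n : ℕ) : ℝ[X] :=
  ∑ k ∈ Finset.range n, C ((k.factorial : ℝ)⁻¹) * scaledHermite τ k ^ 2

/-- Christoffel–Darboux type formula for the derivative of the diagonal kernel. -/
lemma smul_derivative_hermiteKernel (τ : ℝ) (m : ℕ) :
    (1 + τ) • derivative (hermiteKernel τ (m + 1)) = (2 : ℝ) • (X * hermiteKernel τ (m + 1))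
      - (2 : ℝ) • (C ((m.factorial : ℝ)⁻¹) * (scaledHermite τ (m + 1) * scaledHermite τ m)) := by
  induction m with
  | zero => simp [hermiteKernel, scaledHermite]
  | succ m ih =>
    have hfac : C ((m.factorial : ℝ)⁻¹) = C (((m + 1).factorial : ℝ)⁻¹) * C ((m : ℝ) + 1) := by
      rw [← C_mul, Nat.factorial_succ]
      congr 1
      push_cast
      field_simp
    have hC2 : (C 2 : ℝ[X]) = 2 := rfl
    rw [hermiteKernel, Finset.sum_range_succ, ← hermiteKernel, derivative_add, smul_add, ih,
      derivative_C_mul, derivative_pow, derivative_scaledHermite_succ, hfac]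
    simp only [smul_eq_C_mul, scaledHermite, map_add, map_mul, map_one, hC2]
    norm_num [hC2]
    ring

lemma uF_eq_tiltedGaussian (v : ℝ≥0) (hv : v ≠ 0) (m : ℕ) :
    uF (2 * v - 1) (m + 2)
      = fun t => √v * tiltedGaussian v t (hermiteKernel (2 * v - 1) (m + 1)) := by
  funext t
  have hv' : (0 : ℝ) < v := by exact_mod_cast pos_iff_ne_zero.mpr hv
  rw [uF, tiltedGaussian_apply, integral_gaussianReal_eq_integral_smul hv, ← integral_const_mul]
  refine integral_congr_ae (Filter.Eventually.of_forall fun x => ?_)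
  have hS : (hermiteKernel (2 * v - 1) (m + 1)).eval x
      = ∑ k ∈ Finset.range (m + 1), CH (2 * v - 1) k x ^ 2 / (k.factorial : ℝ) := by
    simp [hermiteKernel, eval_finsetSum, eval_scaledHermite, div_eq_inv_mul]
  have he : -x ^ 2 / (1 + (2 * (v : ℝ) - 1)) = -(x - 0) ^ 2 / (2 * v) := by
    ring_nf
  simp only [R1, gaussianPDFReal, smul_eq_mul, hS, he,
    show m + 2 - 1 = m + 1 from rfl]
  rw [Real.sqrt_mul (by positivity) (v : ℝ)]
  have : √(v : ℝ) ≠ 0 := (Real.sqrt_pos.mpr hv').ne'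
  field_simp

/-- The third-order equation with the derivatives `u_k` and the tilted moments of the quadratic
Hermite products as unknowns: the moments can be eliminated linearly. -/
lemma third_order_relation_of_moments {τ n t : ℝ} (hs : 1 + τ ≠ 0) (ht : t ≠ 0)
    {u A B D : ℕ → ℝ}
    (hU : ∀ k : ℕ, (1 + τ) * (t * u k + k * u (k - 1)) = 2 * B k)
    (hA : ∀ k : ℕ, 2 * A (k + 1) = (1 + τ) * (k * A (k - 1) + 2 * n * B k + t * A k))
    (hD : ∀ k : ℕ, 2 * D (k + 1) = (1 + τ) * (2 * B k - τ * t * D k - τ * k * D (k - 1)))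
    (hB : ∀ k : ℕ, (1 - τ) * B (k + 1) + (1 + τ) * τ * t * B k + (1 + τ) * τ * k * B (k - 1)
      = (1 + τ) * (A k - n * τ * D k)) :
    ((1 - τ) / 2) * u 3
    + (-((1 - 4 * τ + τ ^ 2) * (1 + τ) / 4) * t + (1 - τ) / t) * u 2
    + (-(1 + τ) * ((3 * τ * (1 - τ ^ 2) / 8) * t ^ 2 + ((1 - τ ^ 2) / 2) * n
        + (1 - 5 * τ + τ ^ 2) / 2) - (1 - τ) / t ^ 2) * u 1
    + (-((τ ^ 2 * (1 + τ) / 8) * t ^ 2 + (τ * (1 + τ) / 2) * n + 5 * τ * (1 - τ) / 8)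
        * (1 + τ) ^ 2 * t) * u 0 = 0 := by
  have hU0 := hU 0
  have hU1 := hU 1
  have hU2 := hU 2
  have hU3 := hU 3
  have hA0 := hA 0
  have hA1 := hA 1
  have hD0 := hD 0
  have hD1 := hD 1
  have hB0 := hB 0
  have hB1 := hB 1
  have hB2 := hB 2
  norm_num at hU0 hU1 hU2 hU3 hA0 hA1 hD0 hD1 hB0 hB1 hB2
  -- the two relations involving only `B` and `F = A + n τ² D`
  have hF0 : 2 * (1 - τ) * B 2 + 2 * (1 + τ) * τ * t * B 1 + 2 * (1 + τ) * τ * B 0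
      = (1 + τ) ^ 2 * (2 * n * (1 - τ) * B 0 + t * (A 0 + n * τ ^ 2 * D 0)) := by
    linear_combination 2 * hB1 + (1 + τ) * hA0 - (1 + τ) * n * τ * hD0
  have hF1 : 2 * (1 - τ) * B 3 + 2 * (1 + τ) * τ * t * B 2 + 4 * (1 + τ) * τ * B 1
      = (1 + τ) ^ 2 * (A 0 + n * τ ^ 2 * D 0 + 2 * n * (1 - τ) * B 1
        + t * (A 1 + n * τ ^ 2 * D 1)) := by
    linear_combination 2 * hB2 + (1 + τ) * hA1 - (1 + τ) * n * τ * hD1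
  have hF : 2 * (A 1 + n * τ ^ 2 * D 1) = (1 + τ) * 2 * n * (1 + τ ^ 2) * B 0
      + t * τ * ((1 - τ) * B 1 + (1 + τ) * τ * t * B 0)
      + (1 + τ) * t * (1 - τ) * (A 0 + n * τ ^ 2 * D 0) := by
    linear_combination hA0 + n * τ ^ 2 * hD0 - t * τ * hB0
  have hBs : 4 * (1 - τ) * t * B 3
      + (4 * (1 + τ) * τ * t ^ 2 - 2 * (1 - τ) * (2 + (1 + τ) * (1 - τ) * t ^ 2)) * B 2
      + (8 * (1 + τ) * τ * t - 4 * (1 + τ) ^ 2 * n * (1 - τ) * t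
        - (1 + τ) ^ 2 * t ^ 3 * τ * (1 - τ)
        - (2 + (1 + τ) * (1 - τ) * t ^ 2) * 2 * (1 + τ) * τ * t) * B 1
      + (-2 * (1 + τ) ^ 3 * t ^ 2 * n * (1 + τ ^ 2) - (1 + τ) ^ 3 * τ ^ 2 * t ^ 4
        - (2 + (1 + τ) * (1 - τ) * t ^ 2) * (2 * (1 + τ) * τ - 2 * (1 + τ) ^ 2 * n * (1 - τ)))
        * B 0 = 0 := by
    linear_combination 2 * t * hF1 + (1 + τ) ^ 2 * t ^ 2 * hF
      - (2 + (1 + τ) * (1 - τ) * t ^ 2) * hF0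
  have hprod : 4 * (1 + τ) * t ^ 2 * (((1 - τ) / 2) * u 3
    + (-((1 - 4 * τ + τ ^ 2) * (1 + τ) / 4) * t + (1 - τ) / t) * u 2
    + (-(1 + τ) * ((3 * τ * (1 - τ ^ 2) / 8) * t ^ 2 + ((1 - τ ^ 2) / 2) * n
        + (1 - 5 * τ + τ ^ 2) / 2) - (1 - τ) / t ^ 2) * u 1
    + (-((τ ^ 2 * (1 + τ) / 8) * t ^ 2 + (τ * (1 + τ) / 2) * n + 5 * τ * (1 - τ) / 8)
        * (1 + τ) ^ 2 * t) * u 0) = 0 := by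
    have e1 : t ^ 2 * ((1 - τ) / t) = (1 - τ) * t := by field_simp
    have e2 : t ^ 2 * ((1 - τ) / t ^ 2) = 1 - τ := by field_simp
    linear_combination hBs + 4 * (1 + τ) * u 2 * e1 - 4 * (1 + τ) * u 1 * e2
      + 2 * (1 - τ) * t * hU3
      + (2 * (1 + τ) * τ * t ^ 2 - (1 - τ) * (2 + (1 + τ) * (1 - τ) * t ^ 2)) * hU2
      + (8 * (1 + τ) * τ * t - 4 * (1 + τ) ^ 2 * n * (1 - τ) * t
        - (1 + τ) ^ 2 * t ^ 3 * τ * (1 - τ)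
        - (2 + (1 + τ) * (1 - τ) * t ^ 2) * 2 * (1 + τ) * τ * t) / 2 * hU1
      + (-2 * (1 + τ) ^ 3 * t ^ 2 * n * (1 + τ ^ 2) - (1 + τ) ^ 3 * τ ^ 2 * t ^ 4
        - (2 + (1 + τ) * (1 - τ) * t ^ 2) * (2 * (1 + τ) * τ - 2 * (1 + τ) ^ 2 * n * (1 - τ)))
        / 2 * hU0
  simpa [hs, ht] using hprod

/-- **Theorem (Third-order ODE for the elliptic GinUE part of the MGF).**
For every `τ ∈ [0,1]` and every even integer `N ≥ 2`,
`a_3(t)u‴(t) + a_2(t)u″(t) + a_1(t)u′(t) + a_0(t)u(t) = 0` for all real `t ≠ 0`. -/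
theorem u_third_order_ODE (τ : ℝ) (hτ : τ ∈ Set.Icc (0:ℝ) 1)
    (N : ℕ) (hNeven : Even N) (hN2 : 2 ≤ N) (t : ℝ) (ht : t ≠ 0) :
    ((1-τ)/2) * iteratedDeriv 3 (uF τ N) t
    + (-((1-4*τ+τ^2)*(1+τ)/4)*t + (1-τ)/t) * iteratedDeriv 2 (uF τ N) t
    + (-(1+τ)*((3*τ*(1-τ^2)/8)*t^2 + ((1-τ^2)/2)*((N:ℝ)-1) + (1-5*τ+τ^2)/2)
        - (1-τ)/t^2) * deriv (uF τ N) t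
    + (-((τ^2*(1+τ)/8)*t^2 + (τ*(1+τ)/2)*((N:ℝ)-1) + 5*τ*(1-τ)/8) * (1+τ)^2 * t)
        * uF τ N t = 0 := by
  obtain ⟨m, rfl⟩ := Nat.exists_eq_add_of_le' hN2
  obtain ⟨v, hv⟩ : ∃ v : ℝ≥0, (v : ℝ) = (1 + τ) / 2 :=
    ⟨⟨(1 + τ) / 2, by linarith [hτ.1]⟩, rfl⟩
  have hs : 1 + τ ≠ 0 := by linarith [hτ.1]
  have hv0 : v ≠ 0 := by
    rintro rfl
    exact hs (by simpa using hv.symm)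
  obtain rfl : τ = 2 * v - 1 := by rw [hv]; ring
  clear hv
  generalize hτv : 2 * (v : ℝ) - 1 = τ at *
  have hv : (v : ℝ) = (1 + τ) / 2 := by rw [← hτv]; ring
  have hu : uF τ (m + 2) = fun s => tiltedGaussian v s (√v • hermiteKernel τ (m + 1)) := by
    simpa [hτv] using uF_eq_tiltedGaussian v hv0 m
  rw [← iteratedDeriv_one, hu]
  simp only [iteratedDeriv_tiltedGaussian]
  set c : ℝ := √v * (m.factorial : ℝ)⁻¹ with hc
  set S := √v • hermiteKernel τ (m + 1) with hS
  set p := scaledHermite τ (m + 1) with hp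
  set q := scaledHermite τ m with hq
  have hp' : derivative p = ((m : ℝ) + 1) • q := by
    rw [hp, derivative_scaledHermite_succ, smul_eq_C_mul]
  have hq' : τ • derivative q = X * q - p := smul_derivative_scaledHermite τ m
  have hS' : (1 + τ) • derivative S = (2 : ℝ) • (X * S) - (2 : ℝ) • (c • (p * q)) := by
    rw [hS, derivative_smul, smul_comm, smul_derivative_hermiteKernel, hc, ← smul_eq_C_mul,
      mul_smul_comm]
    module
  have hpp' : derivative (c • p ^ 2) = (2 * ((m : ℝ) + 1)) • (c • (p * q)) := by
    rw [derivative_smul, derivative_sq, hp']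
    simp only [smul_eq_C_mul, map_mul, map_ofNat]
    ring
  have hqq' : τ • derivative (c • q ^ 2)
      = (2 : ℝ) • (X * (c • q ^ 2)) - (2 : ℝ) • (c • (p * q)) := by
    rw [derivative_smul, derivative_sq]
    simp only [smul_eq_C_mul, map_ofNat] at hq' ⊢
    linear_combination 2 * C c * q * hq'
  have hpq' : τ • derivative (c • (p * q)) = (((m : ℝ) + 1) * τ) • (c • q ^ 2)
      + X * (c • (p * q)) - c • p ^ 2 := by
    rw [derivative_smul, derivative_mul, hp']
    simp only [smul_eq_C_mul, map_mul] at hq' ⊢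
    linear_combination C c * p * hq'
  generalize c • p ^ 2 = PP at *
  generalize c • q ^ 2 = QQ at *
  generalize c • (p * q) = PQ at *
  have key := third_order_relation_of_moments (τ := τ) (n := (m : ℝ) + 1) hs ht
    (u := fun k => tiltedGaussian v t (X ^ k * S)) (A := fun k => tiltedGaussian v t (X ^ k * PP))
    (B := fun k => tiltedGaussian v t (X ^ k * PQ)) (D := fun k => tiltedGaussian v t (X ^ k * QQ))
    (fun k => ?_) (fun k => ?_) (fun k => ?_) (fun k => ?_)
  · have hN : ((m + 2 : ℕ) : ℝ) - 1 = (m : ℝ) + 1 := by push_cast; ring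
    simpa only [hN, pow_zero, one_mul] using key
  · have h1 := tiltedGaussian_X_pow_succ_mul v t k S
    have h2 := congrArg (fun Q => tiltedGaussian v t (X ^ k * Q)) hS'
    simp only [mul_sub, mul_smul_comm, map_sub, map_smul, smul_eq_mul, ← mul_assoc,
      ← pow_succ] at h2
    rw [hv] at h1
    linear_combination -2 * h1 - h2
  · have h1 := tiltedGaussian_X_pow_succ_mul v t k PP
    rw [hpp', hv, mul_smul_comm, map_smul, smul_eq_mul] at h1
    linear_combination 2 * h1
  · have h1 := tiltedGaussian_X_pow_succ_mul v t k QQ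
    have h2 := congrArg (fun Q => tiltedGaussian v t (X ^ k * Q)) hqq'
    simp only [mul_sub, mul_smul_comm, map_sub, map_smul, smul_eq_mul, ← mul_assoc,
      ← pow_succ] at h2
    rw [hv] at h1
    linear_combination -2 * τ * h1 - (1 + τ) * h2
  · have h1 := tiltedGaussian_X_pow_succ_mul v t k PQ
    have h2 := congrArg (fun Q => tiltedGaussian v t (X ^ k * Q)) hpq'
    simp only [mul_sub, mul_add, mul_smul_comm, map_sub, map_add, map_smul, smul_eq_mul,
      ← mul_assoc, ← pow_succ] at h2
    rw [hv] at h1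
    linear_combination -2 * τ * h1 - (1 + τ) * h2
end

section
/- (Differential equation linking v and u.) For every τ ∈ [0,1], every even integer N ≥ 2 and every t ∈ ℝ: 4(1−τ)v‴(t) − 4(1+τ)(τ²−3τ+1)·t·v″(t) − 4(1−τ²)(2τ(1+τ)t² + (N−1)(1+τ) + 2−τ)·v′(t) − 4τ(1+τ)²(τ(1+τ)t² + (N−1)(1+τ) + 3−2τ)·t·v(t) = 2(1−τ)²(1+τ)·t·u″(t) + (1−τ²)(5τ(1+τ)t² + 4(1−τ))·u′(t) + τ(1+τ)²(3τ(1+τ)t² + 7−9τ)·t·u(t). -/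
open Real MeasureTheory Finset

open Filter

/-- Continuous functions that decay faster than every exponential. -/
def SuperexpDecay (f : ℝ → ℝ) : Prop :=
  Continuous f ∧ ∀ b : ℝ, ∃ C : ℝ, ∀ x, |f x| ≤ C * exp (-(b * |x|))

namespace SuperexpDecay

variable {f g : ℝ → ℝ}

theorem add (hf : SuperexpDecay f) (hg : SuperexpDecay g) :
    SuperexpDecay (fun x => f x + g x) := by
  refine ⟨hf.1.add hg.1, fun b => ?_⟩
  obtain ⟨C, hC⟩ := hf.2 b
  obtain ⟨D, hD⟩ := hg.2 b
  refine ⟨C + D, fun x => (abs_add_le _ _).trans ?_⟩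
  linarith [hC x, hD x]

theorem bounded (hf : SuperexpDecay f) : ∃ C, ∀ x, |f x| ≤ C := by
  obtain ⟨C, hC⟩ := hf.2 0
  exact ⟨C, fun x => by simpa using hC x⟩

theorem mul_bounded (hf : SuperexpDecay f) (hg : Continuous g) (hb : ∃ C, ∀ x, |g x| ≤ C) :
    SuperexpDecay (fun x => f x * g x) := by
  refine ⟨hf.1.mul hg, fun b => ?_⟩
  obtain ⟨C, hC⟩ := hf.2 b
  obtain ⟨D, hD⟩ := hb
  refine ⟨C * D, fun x => ?_⟩
  rw [abs_mul]
  calc |f x| * |g x| ≤ (C * exp (-(b * |x|))) * D :=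
        mul_le_mul (hC x) (hD x) (abs_nonneg _) ((abs_nonneg _).trans (hC x))
    _ = _ := by ring

theorem mul (hf : SuperexpDecay f) (hg : SuperexpDecay g) : SuperexpDecay (fun x => f x * g x) :=
  hf.mul_bounded hg.1 hg.bounded

theorem const_mul (c : ℝ) (hf : SuperexpDecay f) : SuperexpDecay (fun x => c * f x) := by
  simpa only [mul_comm c] using hf.mul_bounded (continuous_const (y := c)) ⟨|c|, fun _ => le_rfl⟩

theorem id_mul (hf : SuperexpDecay f) : SuperexpDecay (fun x => x * f x) := by
  refine ⟨continuous_id.mul hf.1, fun b => ?_⟩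
  obtain ⟨C, hC⟩ := hf.2 (b + 1)
  refine ⟨C, fun x => ?_⟩
  have hx : |x| ≤ exp |x| := by linarith [add_one_le_exp |x|]
  rw [abs_mul]
  calc |x| * |f x| ≤ exp |x| * (C * exp (-((b + 1) * |x|))) :=
        mul_le_mul hx (hC x) (abs_nonneg _) (exp_pos _).le
    _ = C * (exp |x| * exp (-((b + 1) * |x|))) := by ring
    _ = _ := by rw [← exp_add]; ring_nf

theorem pow_mul (hf : SuperexpDecay f) (j : ℕ) : SuperexpDecay (fun x => x ^ j * f x) := by
  induction j with
  | zero => simpa using hf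
  | succ j ih => simpa only [pow_succ', mul_assoc] using ih.id_mul

theorem sum {ι : Type*} (s : Finset ι) {F : ι → ℝ → ℝ} (hF : ∀ i ∈ s, SuperexpDecay (F i)) :
    SuperexpDecay (fun x => ∑ i ∈ s, F i x) := by
  classical
  induction s using Finset.induction_on with
  | empty => exact ⟨by simpa using continuous_const, fun b => ⟨0, by simp⟩⟩
  | insert i s his ih =>
    simp only [Finset.sum_insert his]
    exact (hF i (by simp)).add (ih fun j hj => hF j (by simp [hj]))

/-- A locally uniform integrable bound for `exp (t * x) * f x`. -/
theorem exists_bound (hf : SuperexpDecay f) (T : ℝ) :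
    ∃ C : ℝ, ∀ t x, |t| ≤ T → |exp (t * x) * f x| ≤ C * (1 + x ^ 2)⁻¹ := by
  obtain ⟨C, hC⟩ := hf.2 (T + 1)
  have hC0 : 0 ≤ C := by simpa using (abs_nonneg _).trans (hC 0)
  refine ⟨C * 2, fun t x ht => ?_⟩
  have h1 : t * x ≤ T * |x| := by
    calc t * x ≤ |t * x| := le_abs_self _
      _ = |t| * |x| := abs_mul _ _
      _ ≤ _ := by gcongr
  have h2 : exp (-|x|) ≤ 2 * (1 + x ^ 2)⁻¹ := by
    have := quadratic_le_exp_of_nonneg (abs_nonneg x)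
    rw [sq_abs] at this
    rw [exp_neg, ← div_eq_mul_inv, inv_eq_one_div, div_le_div_iff₀ (exp_pos _) (by positivity)]
    linarith [abs_nonneg x]
  rw [abs_mul, abs_exp]
  calc exp (t * x) * |f x| ≤ exp (T * |x|) * (C * exp (-((T + 1) * |x|))) := by
        gcongr
        exact hC x
    _ = C * (exp (T * |x|) * exp (-((T + 1) * |x|))) := by ring
    _ = C * exp (-|x|) := by rw [← exp_add]; ring_nf
    _ ≤ C * (2 * (1 + x ^ 2)⁻¹) := by gcongr
    _ = _ := by ring

theorem integrable_exp_mul (hf : SuperexpDecay f) (t : ℝ) :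
    Integrable (fun x => exp (t * x) * f x) := by
  obtain ⟨C, hC⟩ := hf.exists_bound |t|
  have hc := hf.1
  exact (integrable_inv_one_add_sq.const_mul C).mono' (by fun_prop)
    (Eventually.of_forall fun x => hC t x le_rfl)

theorem hasDerivAt_integral (hf : SuperexpDecay f) (t : ℝ) :
    HasDerivAt (fun s => ∫ x, exp (s * x) * f x) (∫ x, exp (t * x) * (x * f x)) t := by
  have hc := hf.1
  obtain ⟨C, hC⟩ := hf.id_mul.exists_bound (|t| + 1)
  refine (hasDerivAt_integral_of_dominated_loc_of_deriv_le
    (F := fun s x => exp (s * x) * f x) (F' := fun s x => exp (s * x) * (x * f x))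
    (bound := fun x => C * (1 + x ^ 2)⁻¹) (Metric.ball_mem_nhds t one_pos)
    (Eventually.of_forall fun s => by fun_prop) (hf.integrable_exp_mul t) (by fun_prop)
    (Eventually.of_forall fun x s hs => hC s x ?_) (integrable_inv_one_add_sq.const_mul C)
    (Eventually.of_forall fun x s _ => ?_)).2
  · rw [Metric.mem_ball, dist_eq] at hs
    linarith [abs_sub_abs_le_abs_sub s t]
  · have h := (((hasDerivAt_id s).mul_const x).exp).mul_const (f x)
    simp only [id_eq, one_mul] at h
    exact h.congr_deriv (by ring)

end SuperexpDecay

/-- The `j`-th derivative at `t` of the two-sided Laplace transform of `f`. -/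
noncomputable def laplaceMoment (t : ℝ) (j : ℕ) (f : ℝ → ℝ) : ℝ :=
  ∫ x, exp (t * x) * (x ^ j * f x)

theorem hasDerivAt_laplaceMoment {f : ℝ → ℝ} (hf : SuperexpDecay f) (j : ℕ) (t : ℝ) :
    HasDerivAt (fun s => laplaceMoment s j f) (laplaceMoment t (j + 1) f) t := by
  simpa only [laplaceMoment, pow_succ', mul_assoc] using (hf.pow_mul j).hasDerivAt_integral t

theorem iteratedDeriv_laplaceMoment {f : ℝ → ℝ} (hf : SuperexpDecay f) (j : ℕ) :
    iteratedDeriv j (fun s => laplaceMoment s 0 f) = fun s => laplaceMoment s j f := by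
  induction j with
  | zero => simp
  | succ j ih =>
    rw [iteratedDeriv_succ, ih]
    exact funext fun t => (hasDerivAt_laplaceMoment hf j t).deriv

/-- Integration by parts for the moments of the Laplace transform. -/
theorem mul_laplaceMoment {f f' : ℝ → ℝ} (hf : SuperexpDecay f) (hf' : SuperexpDecay f')
    (hd : ∀ x, HasDerivAt f (f' x) x) (j : ℕ) (t : ℝ) :
    t * laplaceMoment t j f =
      -(j * laplaceMoment t (j - 1) f + laplaceMoment t j f') := by
  have i1 := ((hf.pow_mul j).integrable_exp_mul t).const_mul t
  have i2 := ((hf.pow_mul (j - 1)).integrable_exp_mul t).const_mul (j : ℝ)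
  have i3 := (hf'.pow_mul j).integrable_exp_mul t
  have i23 : Integrable (fun x => j * (exp (t * x) * (x ^ (j - 1) * f x)) +
      exp (t * x) * (x ^ j * f' x)) := i2.add i3
  have key : ∫ x, (t * (exp (t * x) * (x ^ j * f x)) +
      (j * (exp (t * x) * (x ^ (j - 1) * f x)) + exp (t * x) * (x ^ j * f' x))) = 0 := by
    refine integral_eq_zero_of_hasDerivAt_of_integrable
      (f := fun x => exp (t * x) * (x ^ j * f x)) (fun x => ?_) (i1.add i23)
      ((hf.pow_mul j).integrable_exp_mul t)
    have h := (((hasDerivAt_id x).const_mul t).exp).mul ((hasDerivAt_pow j x).mul (hd x))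
    simp only [id_eq, mul_one] at h
    exact h.congr_deriv (by simp only [Pi.mul_apply]; ring)
  rw [integral_add i1 i23, integral_add i2 i3, integral_const_mul,
    integral_const_mul] at key
  simp only [laplaceMoment]
  linarith

/-- The weighted polynomials `exp (-x² / (2 (1 + τ))) C_k(x)`. -/
noncomputable def weightedCH (τ : ℝ) (k : ℕ) (x : ℝ) : ℝ :=
  exp (-x ^ 2 / (2 * (1 + τ))) * CH τ k x

theorem CH_succ (τ : ℝ) (k : ℕ) (x : ℝ) :
    CH τ (k + 1) x = x * CH τ k x - k * τ * CH τ (k - 1) x := by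
  cases k with
  | zero => simp [CH]
  | succ k => simp [CH]

theorem hasDerivAt_CH (τ : ℝ) (k : ℕ) (x : ℝ) :
    HasDerivAt (CH τ k) (k * CH τ (k - 1) x) x := by
  induction k using Nat.strong_induction_on with
  | _ k ih =>
    match k, ih with
    | 0, _ => simpa [CH] using hasDerivAt_const x (1 : ℝ)
    | 1, _ => simpa [CH] using hasDerivAt_id' x
    | k + 2, ih =>
      have h := ((hasDerivAt_id x).mul (ih (k + 1) (by omega))).sub
        ((ih k (by omega)).const_mul (((k : ℝ) + 1) * τ))
      refine h.congr_deriv ?_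
      have := CH_succ τ k x
      simp only [id_eq, Nat.add_sub_cancel, show k + 2 - 1 = k + 1 by omega]
      push_cast
      linear_combination (-(k : ℝ) - 1) * this

theorem weightedCH_succ (τ : ℝ) (k : ℕ) (x : ℝ) :
    weightedCH τ (k + 1) x = x * weightedCH τ k x - k * τ * weightedCH τ (k - 1) x := by
  simp only [weightedCH, CH_succ τ k x]
  ring

theorem hasDerivAt_weightedCH {τ : ℝ} (ha : 1 + τ ≠ 0) (k : ℕ) (x : ℝ) :
    HasDerivAt (weightedCH τ k)
      (-1 / (1 + τ) * (x * weightedCH τ k x) + k * weightedCH τ (k - 1) x) x := by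
  have h := ((((hasDerivAt_pow 2 x).neg).div_const (2 * (1 + τ))).exp).mul (hasDerivAt_CH τ k x)
  refine h.congr_deriv ?_
  simp only [weightedCH, Pi.neg_apply]
  field_simp
  push_cast
  ring

theorem superexpDecay_weightedCH {τ : ℝ} (ha : 0 < 1 + τ) (k : ℕ) :
    SuperexpDecay (weightedCH τ k) := by
  induction k using Nat.strong_induction_on with
  | _ k ih =>
    match k, ih with
    | 0, _ =>
      refine ⟨by unfold weightedCH CH; fun_prop, fun b =>
        ⟨exp (b ^ 2 * (1 + τ) / 2), fun x => ?_⟩⟩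
      simp only [weightedCH, CH, mul_one]
      rw [abs_exp, ← exp_add, exp_le_exp, ← sub_nonneg]
      have : b ^ 2 * (1 + τ) / 2 + -(b * |x|) - -x ^ 2 / (2 * (1 + τ))
          = (|x| - b * (1 + τ)) ^ 2 / (2 * (1 + τ)) := by
        rw [sub_sq, sq_abs]
        field_simp
        ring
      rw [this]
      positivity
    | k + 1, ih =>
      have h := (ih k (by omega)).id_mul.add
        ((ih (k - 1) (by omega)).const_mul (-((k : ℝ) * τ)))
      convert h using 2 with x
      rw [weightedCH_succ]
      ring

theorem hasDerivAt_sum_weightedCH_sq {τ : ℝ} (ha : 1 + τ ≠ 0) (n : ℕ) (x : ℝ) :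
    HasDerivAt (fun y => ∑ k ∈ Finset.range (n + 1), weightedCH τ k y ^ 2 / (k.factorial : ℝ))
      (-2 / ((1 + τ) * n.factorial) * (weightedCH τ n x * weightedCH τ (n + 1) x)) x := by
  induction n with
  | zero =>
    simp only [zero_add, Finset.sum_range_one, Nat.factorial_zero, Nat.cast_one, div_one]
    refine ((hasDerivAt_weightedCH ha 0 x).pow 2).congr_deriv ?_
    have := weightedCH_succ τ 0 x
    simp only [zero_add] at this
    rw [this]
    push_cast
    field_simp
    ring
  | succ n ih =>
    simp only [Finset.sum_range_succ _ (n + 1)]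
    refine (ih.add (((hasDerivAt_weightedCH ha (n + 1) x).pow 2).div_const _)).congr_deriv ?_
    rw [weightedCH_succ τ (n + 1) x, Nat.factorial_succ]
    simp only [Nat.add_sub_cancel]
    have h1 : (n.factorial : ℝ) ≠ 0 := by positivity
    have h2 : (n : ℝ) + 1 ≠ 0 := by positivity
    push_cast
    field_simp
    ring

/-- The antiderivative of `weightedCH τ k` vanishing at the origin. -/
noncomputable def weightedCHPrimitive (τ : ℝ) (k : ℕ) (x : ℝ) : ℝ :=
  ∫ u in (0 : ℝ)..x, weightedCH τ k u

theorem hasDerivAt_weightedCHPrimitive {τ : ℝ} (ha : 0 < 1 + τ) (k : ℕ) (x : ℝ) :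
    HasDerivAt (weightedCHPrimitive τ k) (weightedCH τ k x) x :=
  (superexpDecay_weightedCH ha k).1.integral_hasStrictDerivAt 0 x |>.hasDerivAt

theorem bounded_weightedCHPrimitive {τ : ℝ} (ha : 0 < 1 + τ) (k : ℕ) :
    ∃ C, ∀ x, |weightedCHPrimitive τ k x| ≤ C := by
  have hi : Integrable (weightedCH τ k) := by
    simpa using (superexpDecay_weightedCH ha k).integrable_exp_mul 0
  refine ⟨∫ u, |weightedCH τ k u|, fun x => ?_⟩
  refine (intervalIntegral.norm_integral_le_integral_norm_uIoc (f := weightedCH τ k)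
    (μ := volume)).trans ?_
  exact setIntegral_le_integral hi.norm (Eventually.of_forall fun u => norm_nonneg _)

theorem R1_eq (τ : ℝ) (n : ℕ) (x : ℝ) :
    R1 τ (n + 2) x = (√(2 * π))⁻¹ *
      ∑ k ∈ Finset.range (n + 1), weightedCH τ k x ^ 2 / (k.factorial : ℝ) := by
  have hw : exp (-x ^ 2 / (1 + τ)) = exp (-x ^ 2 / (2 * (1 + τ))) ^ 2 := by
    rw [← exp_nat_mul]
    congr 1
    rw [Nat.cast_ofNat, ← mul_div_assoc, mul_div_mul_left _ _ two_ne_zero]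
  simp only [R1, weightedCH, mul_pow, hw, show n + 2 - 1 = n + 1 by omega, Finset.mul_sum]
  exact Finset.sum_congr rfl fun k _ => by ring

theorem R2_eq (τ : ℝ) (n : ℕ) (x : ℝ) :
    R2 τ (n + 2) x = (√(2 * π))⁻¹ * (1 / ((1 + τ) * n.factorial)) *
      (weightedCH τ (n + 1) x * weightedCHPrimitive τ n x) := by
  simp only [R2, weightedCH, weightedCHPrimitive, show n + 2 - 1 = n + 1 by omega,
    show n + 2 - 2 = n by omega]
  ring

/-- The pointwise identity behind the differential equation; the hypotheses record the
derivatives of `A` and `B` up to third order. -/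
theorem density_identity (τ n x A B F P Q A1 A2 P1 B1 B2 B3 : ℝ) (ha : 1 + τ ≠ 0)
    (hP : τ * P = x * A - B) (hQ : τ * Q = x * P - n * A)
    (hP1 : P1 = -1 / (1 + τ) * (x * P) + Q)
    (hA1 : A1 = -1 / (1 + τ) * (x * A) + P)
    (hA2 : A2 = -1 / (1 + τ) * (A + x * A1) + P1)
    (hB1 : B1 = -1 / (1 + τ) * (x * B) + (n + 1) * A)
    (hB2 : B2 = -1 / (1 + τ) * (B + x * B1) + (n + 1) * A1)
    (hB3 : B3 = -1 / (1 + τ) * (2 * B1 + x * B2) + (n + 1) * A2) :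
    4*(1-τ) * (x^3 * (B*F))
    + 4*(1+τ)*(τ^2-3*τ+1) * (2*(x*(B*F)) + x^2*(B1*F+B*A))
    - 4*(1-τ^2) * (2*τ*(1+τ)*(2*(B1*F+B*A) + x*(B2*F+2*(B1*A)+B*A1))
        + ((n+1)*(1+τ) + 2-τ) * (x*(B*F)))
    + 4*τ*(1+τ)^2 * (τ*(1+τ)*(B3*F+3*(B2*A)+3*(B1*A1)+B*A2)
        + ((n+1)*(1+τ) + 3-2*τ) * (B1*F+B*A))
    = -2 * (-(2*(1-τ)^2*(1+τ) * (x^2*(A*B)))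
    + (1-τ^2) * (5*τ*(1+τ)*(2*(A*B) + x*(A1*B+A*B1)))
    - τ*(1+τ)^2 * (3*τ*(1+τ)*(A2*B+2*(A1*B1)+A*B2) + (7-9*τ)*(A*B))) := by
  obtain ⟨i, hi⟩ : ∃ i, i = (1 + τ)⁻¹ := ⟨_, rfl⟩
  have hi1 : (1 + τ) * i = 1 := by rw [hi]; field_simp
  simp only [div_eq_mul_inv, ← hi] at hP1 hA1 hA2 hB1 hB2 hB3
  have hτi : τ * i = 1 - i := by linear_combination hi1
  have tA1 : τ * A1 = x * i * A - B := by
    rw [hA1]; linear_combination hP - x * A * hi1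
  have tB2 : τ * B2 = -(1 - i) * B  - x * (1 - i) * B1 + (n + 1) * (x * i * A - B) := by
    rw [hB2]; linear_combination (-B - x * B1) * hτi + (n + 1) * tA1
  have tQ : τ ^ 2 * Q = x * (x * A - B) - n * τ * A := by
    linear_combination τ * hQ + x * hP
  have tA2 : τ ^ 2 * A2 = -τ * (1 - i) * A - x * (1 - i) * (x * i * A - B)
      - x * (1 - i) * (x * A - B) + x * (x * A - B) - n * τ * A := by
    rw [hA2, hP1]
    linear_combination tQ + (-τ * A - x * τ * A1 - x * τ * P) * hτi - x * (1-i) * tA1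
      - x * (1 - i) * hP
  have tB3 : τ ^ 2 * B3 = -2 * τ * (1 - i) * B1 - x * (1 - i) * (-(1 - i) * B
      - x * (1 - i) * B1 + (n + 1) * (x * i * A - B)) + (n + 1) * (-τ * (1 - i) * A
      - x * (1 - i) * (x * i * A - B) - x * (1 - i) * (x * A - B) + x * (x * A - B)
      - n * τ * A) := by
    rw [hB3]
    linear_combination (-2 * τ * B1 - x * τ * B2) * hτi - x * (1 - i) * tB2 + (n + 1) * tA2
  linear_combination (norm := skip)
    (-8 * (1-τ^2) * (1+τ) * x * F + 6 * τ * (1+τ)^3 * A) * tB2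
    + 2 * (1-τ^2) * (1+τ) * x * B * tA1 - 2 * (1+τ)^3 * B * tA2 + 4 * (1+τ)^3 * F * tB3
  rw [hB1, hi]
  field_simp
  ring

theorem sum_laplaceMoment_eq_zero {m : ℕ} (c : Fin m → ℝ) (j : Fin m → ℕ) (f : Fin m → ℝ → ℝ)
    (hf : ∀ i, SuperexpDecay (f i)) (h : ∀ x, ∑ i, c i * (x ^ j i * f i x) = 0) (t : ℝ) :
    ∑ i, c i * laplaceMoment t (j i) (f i) = 0 := by
  simp only [laplaceMoment, ← integral_const_mul]
  rw [← integral_finsetSum _ fun i _ => (((hf i).pow_mul (j i)).integrable_exp_mul t).const_mul _]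
  refine (integral_congr_ae (Eventually.of_forall fun x => ?_)).trans (integral_zero ℝ ℝ)
  calc ∑ i, c i * (exp (t * x) * (x ^ j i * f i x))
      = exp (t * x) * ∑ i, c i * (x ^ j i * f i x) := by
        rw [Finset.mul_sum]; exact Finset.sum_congr rfl fun i _ => by ring
    _ = 0 := by rw [h, mul_zero]

/-- The differential equation for the Laplace transforms of `B * F` and `U`, for functions with
the same differential and recurrence relations as the weighted polynomials. -/
theorem laplaceMoment_ode {τ n : ℝ} (ha : 1 + τ ≠ 0) {A B F P Q U : ℝ → ℝ}
    (dA : SuperexpDecay A) (dB : SuperexpDecay B) (dP : SuperexpDecay P) (dQ : SuperexpDecay Q)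
    (dU : SuperexpDecay U) (bF : ∃ C, ∀ x, |F x| ≤ C)
    (hA : ∀ x, HasDerivAt A (-1 / (1 + τ) * (x * A x) + P x) x)
    (hP : ∀ x, HasDerivAt P (-1 / (1 + τ) * (x * P x) + Q x) x)
    (hB : ∀ x, HasDerivAt B (-1 / (1 + τ) * (x * B x) + (n + 1) * A x) x)
    (hF : ∀ x, HasDerivAt F (A x) x)
    (hU : ∀ x, HasDerivAt U (-2 * (A x * B x)) x)
    (rP : ∀ x, τ * P x = x * A x - B x) (rQ : ∀ x, τ * Q x = x * P x - n * A x) (t : ℝ) :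
    4*(1-τ) * laplaceMoment t 3 (fun x => B x * F x)
    - 4*(1+τ)*(τ^2-3*τ+1) * t * laplaceMoment t 2 (fun x => B x * F x)
    - 4*(1-τ^2) * (2*τ*(1+τ)*t^2 + (n+1)*(1+τ) + 2-τ) * laplaceMoment t 1 (fun x => B x * F x)
    - 4*τ*(1+τ)^2 * (τ*(1+τ)*t^2 + (n+1)*(1+τ) + 3-2*τ) * t
      * laplaceMoment t 0 (fun x => B x * F x)
    = 2*(1-τ)^2*(1+τ) * t * laplaceMoment t 2 U
    + (1-τ^2) * (5*τ*(1+τ)*t^2 + 4*(1-τ)) * laplaceMoment t 1 U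
    + τ*(1+τ)^2 * (3*τ*(1+τ)*t^2 + 7-9*τ) * t * laplaceMoment t 0 U := by
  have cF : Continuous F := continuous_iff_continuousAt.2 fun x => (hF x).continuousAt
  obtain ⟨P1, eP1⟩ : ∃ f : ℝ → ℝ, f = fun x => -1 / (1 + τ) * (x * P x) + Q x := ⟨_, rfl⟩
  obtain ⟨A1, eA1⟩ : ∃ f : ℝ → ℝ, f = fun x => -1 / (1 + τ) * (x * A x) + P x := ⟨_, rfl⟩
  obtain ⟨A2, eA2⟩ : ∃ f : ℝ → ℝ, f = fun x => -1 / (1 + τ) * (A x + x * A1 x) + P1 x :=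
    ⟨_, rfl⟩
  obtain ⟨B1, eB1⟩ : ∃ f : ℝ → ℝ, f = fun x => -1 / (1 + τ) * (x * B x) + (n + 1) * A x :=
    ⟨_, rfl⟩
  obtain ⟨B2, eB2⟩ : ∃ f : ℝ → ℝ,
      f = fun x => -1 / (1 + τ) * (B x + x * B1 x) + (n + 1) * A1 x := ⟨_, rfl⟩
  obtain ⟨B3, eB3⟩ : ∃ f : ℝ → ℝ,
      f = fun x => -1 / (1 + τ) * (2 * B1 x + x * B2 x) + (n + 1) * A2 x := ⟨_, rfl⟩
  have dP1 : SuperexpDecay P1 := eP1 ▸ (dP.id_mul.const_mul _).add dQ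
  have dA1 : SuperexpDecay A1 := eA1 ▸ (dA.id_mul.const_mul _).add dP
  have dA2 : SuperexpDecay A2 := eA2 ▸ ((dA.add dA1.id_mul).const_mul _).add dP1
  have dB1 : SuperexpDecay B1 := eB1 ▸ (dB.id_mul.const_mul _).add (dA.const_mul _)
  have dB2 : SuperexpDecay B2 := eB2 ▸ ((dB.add dB1.id_mul).const_mul _).add (dA1.const_mul _)
  have dB3 : SuperexpDecay B3 :=
    eB3 ▸ (((dB1.const_mul 2).add dB2.id_mul).const_mul _).add (dA2.const_mul _)
  have hA' : ∀ x, HasDerivAt A (A1 x) x := by simpa only [eA1] using hA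
  have hB' : ∀ x, HasDerivAt B (B1 x) x := by simpa only [eB1] using hB
  have hP' : ∀ x, HasDerivAt P (P1 x) x := by simpa only [eP1] using hP
  have hA1 : ∀ x, HasDerivAt A1 (A2 x) x := fun x => by
    rw [eA1, eA2]
    exact ((((hasDerivAt_id' x).mul (hA' x)).const_mul _).add (hP' x)).congr_deriv (by ring)
  have hB1 : ∀ x, HasDerivAt B1 (B2 x) x := fun x => by
    rw [eB1, eB2]
    exact ((((hasDerivAt_id' x).mul (hB' x)).const_mul _).add
      ((hA' x).const_mul _)).congr_deriv (by ring)
  have hB2 : ∀ x, HasDerivAt B2 (B3 x) x := fun x => by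
    rw [eB2, eB3]
    exact ((((hB' x).add ((hasDerivAt_id' x).mul (hB1 x))).const_mul _).add
      ((hA1 x).const_mul _)).congr_deriv (by ring)
  obtain ⟨V, eV⟩ : ∃ f : ℝ → ℝ, f = fun x => B x * F x := ⟨_, rfl⟩
  obtain ⟨V1, eV1⟩ : ∃ f : ℝ → ℝ, f = fun x => B1 x * F x + B x * A x := ⟨_, rfl⟩
  obtain ⟨V2, eV2⟩ : ∃ f : ℝ → ℝ, f = fun x => B2 x * F x + 2 * (B1 x * A x) + B x * A1 x :=
    ⟨_, rfl⟩
  obtain ⟨V3, eV3⟩ : ∃ f : ℝ → ℝ,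
      f = fun x => B3 x * F x + 3 * (B2 x * A x) + 3 * (B1 x * A1 x) + B x * A2 x := ⟨_, rfl⟩
  obtain ⟨U1, eU1⟩ : ∃ f : ℝ → ℝ, f = fun x => -2 * (A x * B x) := ⟨_, rfl⟩
  obtain ⟨U2, eU2⟩ : ∃ f : ℝ → ℝ, f = fun x => -2 * (A1 x * B x + A x * B1 x) := ⟨_, rfl⟩
  obtain ⟨U3, eU3⟩ : ∃ f : ℝ → ℝ,
      f = fun x => -2 * (A2 x * B x + 2 * (A1 x * B1 x) + A x * B2 x) := ⟨_, rfl⟩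
  have dV : SuperexpDecay V := eV ▸ dB.mul_bounded cF bF
  have dV1 : SuperexpDecay V1 := eV1 ▸ (dB1.mul_bounded cF bF).add (dB.mul dA)
  have dV2 : SuperexpDecay V2 :=
    eV2 ▸ ((dB2.mul_bounded cF bF).add ((dB1.mul dA).const_mul 2)).add (dB.mul dA1)
  have dV3 : SuperexpDecay V3 :=
    eV3 ▸ (((dB3.mul_bounded cF bF).add ((dB2.mul dA).const_mul 3)).add
      ((dB1.mul dA1).const_mul 3)).add (dB.mul dA2)
  have dU1 : SuperexpDecay U1 := eU1 ▸ (dA.mul dB).const_mul _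
  have dU2 : SuperexpDecay U2 := eU2 ▸ ((dA1.mul dB).add (dA.mul dB1)).const_mul _
  have dU3 : SuperexpDecay U3 :=
    eU3 ▸ (((dA2.mul dB).add ((dA1.mul dB1).const_mul 2)).add (dA.mul dB2)).const_mul _
  have hV : ∀ x, HasDerivAt V (V1 x) x := fun x => by
    rw [eV, eV1]
    exact (hB' x).mul (hF x)
  have hV1 : ∀ x, HasDerivAt V1 (V2 x) x := fun x => by
    rw [eV1, eV2]
    exact (((hB1 x).mul (hF x)).add ((hB' x).mul (hA' x))).congr_deriv (by ring)
  have hV2 : ∀ x, HasDerivAt V2 (V3 x) x := fun x => by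
    rw [eV2, eV3]
    exact ((((hB2 x).mul (hF x)).add (((hB1 x).mul (hA' x)).const_mul 2)).add
      ((hB' x).mul (hA1 x))).congr_deriv (by ring)
  have hU' : ∀ x, HasDerivAt U (U1 x) x := by simpa only [eU1] using hU
  have hU1 : ∀ x, HasDerivAt U1 (U2 x) x := fun x => by
    rw [eU1, eU2]
    exact ((hA' x).mul (hB' x)).const_mul (-2)
  have hU2 : ∀ x, HasDerivAt U2 (U3 x) x := fun x => by
    rw [eU2, eU3]
    exact ((((hA1 x).mul (hB' x)).add ((hA' x).mul (hB1 x))).const_mul (-2)).congr_deriv (by ring)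
  have key := sum_laplaceMoment_eq_zero
    ![4*(1-τ), 8*(1+τ)*(τ^2-3*τ+1) - 4*(1-τ^2)*((n+1)*(1+τ) + 2-τ), 4*(1+τ)*(τ^2-3*τ+1),
      -16*(1-τ^2)*τ*(1+τ) + 4*τ*(1+τ)^2*((n+1)*(1+τ) + 3-2*τ), -8*(1-τ^2)*τ*(1+τ),
      4*τ^2*(1+τ)^3, 2*(1-τ)^2*(1+τ), -10*(1-τ^2)*τ*(1+τ) + τ*(1+τ)^2*(7-9*τ),
      -5*(1-τ^2)*τ*(1+τ), 3*τ^2*(1+τ)^3]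
    ![3, 1, 2, 0, 1, 0, 2, 0, 1, 0] ![V, V, V1, V1, V2, V3, U1, U1, U2, U3]
    (by simp only [Fin.forall_fin_succ]; simp [dV, dV1, dV2, dV3, dU1, dU2, dU3])
    (fun x => by
      have h := density_identity τ n x (A x) (B x) (F x) (P x) (Q x) (A1 x) (A2 x) (P1 x)
        (B1 x) (B2 x) (B3 x) ha (rP x) (rQ x) (by rw [eP1]) (by rw [eA1]) (by rw [eA2])
        (by rw [eB1]) (by rw [eB2]) (by rw [eB3])
      simp [Fin.sum_univ_succ, eV, eV1, eV2, eV3, eU1, eU2, eU3]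
      linear_combination h) t
  simp [Fin.sum_univ_succ] at key
  have v2 := mul_laplaceMoment dV dV1 hV 2 t
  have v1 := mul_laplaceMoment dV dV1 hV 1 t
  have v0 := mul_laplaceMoment dV dV1 hV 0 t
  have v11 := mul_laplaceMoment dV1 dV2 hV1 1 t
  have v10 := mul_laplaceMoment dV1 dV2 hV1 0 t
  have v20 := mul_laplaceMoment dV2 dV3 hV2 0 t
  have u2 := mul_laplaceMoment dU dU1 hU' 2 t
  have u1 := mul_laplaceMoment dU dU1 hU' 1 t
  have u0 := mul_laplaceMoment dU dU1 hU' 0 t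
  have u11 := mul_laplaceMoment dU1 dU2 hU1 1 t
  have u10 := mul_laplaceMoment dU1 dU2 hU1 0 t
  have u20 := mul_laplaceMoment dU2 dU3 hU2 0 t
  norm_num at v2 v1 v0 v11 v10 v20 u2 u1 u0 u11 u10 u20
  rw [← eV]
  linear_combination key - 4*(1+τ)*(τ^2-3*τ+1) * v2
    - 8*(1-τ^2)*τ*(1+τ) * (t * v1 - v0 - v11)
    - 4*τ^2*(1+τ)^3 * (t^2 * v0 - t * v10 + v20)
    - 4*τ*(1+τ)^2 * ((n+1)*(1+τ) + 3-2*τ) * v0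
    - 2*(1-τ)^2*(1+τ) * u2 - 5*(1-τ^2)*τ*(1+τ) * (t * u1 - u0 - u11)
    - 3*τ^2*(1+τ)^3 * (t^2 * u0 - t * u10 + u20) - τ*(1+τ)^2*(7-9*τ) * u0

theorem iteratedDeriv_integral_exp_mul {R f : ℝ → ℝ} {c : ℝ} (hf : SuperexpDecay f)
    (hR : ∀ x, R x = c * f x) (j : ℕ) (t : ℝ) :
    iteratedDeriv j (fun s => ∫ x, exp (s * x) * R x) t = c * laplaceMoment t j f := by
  obtain rfl : R = fun x => c * f x := funext hR
  have h := congrFun (iteratedDeriv_laplaceMoment (hf.const_mul c) j) t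
  simp only [laplaceMoment, pow_zero, one_mul] at h
  rw [h, laplaceMoment, ← integral_const_mul]
  exact integral_congr_ae (Eventually.of_forall fun x => by simp only; ring)

/-- **Theorem (Differential equation linking `v` and `u`).**
For every `τ ∈ [0,1]`, every even integer `N ≥ 2` and every `t ∈ ℝ`, the stated
third-order differential expression in `v` equals the stated second-order one in `u`. -/
theorem v_u_ODE (τ : ℝ) (hτ : τ ∈ Set.Icc (0:ℝ) 1)
    (N : ℕ) (hNeven : Even N) (hN2 : 2 ≤ N) (t : ℝ) :
    4*(1-τ) * iteratedDeriv 3 (vF τ N) t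
    - 4*(1+τ)*(τ^2-3*τ+1) * t * iteratedDeriv 2 (vF τ N) t
    - 4*(1-τ^2) * (2*τ*(1+τ)*t^2 + ((N:ℝ)-1)*(1+τ) + 2-τ) * deriv (vF τ N) t
    - 4*τ*(1+τ)^2 * (τ*(1+τ)*t^2 + ((N:ℝ)-1)*(1+τ) + 3-2*τ) * t * vF τ N t
    = 2*(1-τ)^2*(1+τ) * t * iteratedDeriv 2 (uF τ N) t
    + (1-τ^2) * (5*τ*(1+τ)*t^2 + 4*(1-τ)) * deriv (uF τ N) t
    + τ*(1+τ)^2 * (3*τ*(1+τ)*t^2 + 7-9*τ) * t * uF τ N t := by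
  have ha : 0 < 1 + τ := by linarith [hτ.1]
  obtain ⟨n, rfl⟩ := Nat.exists_eq_add_of_le' hN2
  have dW := superexpDecay_weightedCH ha
  have dS : SuperexpDecay (fun x =>
      ∑ k ∈ Finset.range (n + 1), weightedCH τ k x ^ 2 / (k.factorial : ℝ)) :=
    SuperexpDecay.sum _ fun k _ => by
      simpa only [div_eq_inv_mul, sq] using ((dW k).mul (dW k)).const_mul (k.factorial : ℝ)⁻¹
  have hfac : (n.factorial : ℝ) ≠ 0 := by positivity
  have bF := bounded_weightedCHPrimitive ha n
  have hF := hasDerivAt_weightedCHPrimitive ha n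
  have cF : Continuous (weightedCHPrimitive τ n) :=
    continuous_iff_continuousAt.2 fun x => (hF x).continuousAt
  have dU := dS.const_mul ((1 + τ) * n.factorial)
  have ode := laplaceMoment_ode (n := n) ha.ne' (dW n) (dW (n + 1))
    ((dW (n - 1)).const_mul n) (((dW (n - 1 - 1)).const_mul (n - 1 : ℕ)).const_mul n)
    dU bF (hasDerivAt_weightedCH ha.ne' n)
    (fun x => ((hasDerivAt_weightedCH ha.ne' (n - 1) x).const_mul (n : ℝ)).congr_deriv (by ring))
    (fun x => by simpa using hasDerivAt_weightedCH ha.ne' (n + 1) x) hF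
    (fun x => ((hasDerivAt_sum_weightedCH_sq ha.ne' n x).const_mul _).congr_deriv (by field_simp))
    (fun x => by rw [weightedCH_succ]; ring)
    (fun x => by
      cases n with
      | zero => simp
      | succ n =>
        have := weightedCH_succ τ n x
        simp only [Nat.add_sub_cancel]
        linear_combination ((n + 1 : ℕ) : ℝ) * this) t
  have hv := iteratedDeriv_integral_exp_mul ((dW (n + 1)).mul_bounded cF bF) (R2_eq τ n) (t := t)
  have hu := iteratedDeriv_integral_exp_mul (R := R1 τ (n + 2)) dU
    (c := (√(2 * π))⁻¹ * (1 / ((1 + τ) * n.factorial)))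
    (fun x => by rw [R1_eq]; field_simp) (t := t)
  change ∀ j, iteratedDeriv j (vF τ (n + 2)) t = _ at hv
  change ∀ j, iteratedDeriv j (uF τ (n + 2)) t = _ at hu
  have hv0 := hv 0
  have hu0 := hu 0
  rw [iteratedDeriv_zero] at hv0 hu0
  rw [← iteratedDeriv_one, ← iteratedDeriv_one, hv, hv, hv, hv0, hu, hu, hu0]
  push_cast
  linear_combination ((√(2 * π))⁻¹ * (1 / ((1 + τ) * n.factorial))) * ode
end
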